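/- arXiv:1805.11747 — 6 statements merged into one kernel-verified Lean document; each statement's English description precedes it below -/
import Mathlib

section
/- Assume condition (C1). Then there exists δ₀ > 0 such that, ℙ-almost surely, ∫_{|λ| ≤ δ₀√(I_N)} f(λ)·|ϱ(θ̂_N + λ/√(I_N)) − ϱ(θ₀)|·e^{−λ²/2} dλ → 0 as N → ∞. -/
open MeasureTheory Filter Real

/-- First half of the key lemma for Bernstein–Von Mises: under (C1), there is `δ₀ > 0` such
that ℙ-a.s. the weighted integral over `{|λ| ≤ δ₀ √I_N}` of
`f(λ)|ϱ(θ̂_N + λ/√I_N) − ϱ(θ₀)| e^{−λ²/2}` tends to `0`. -/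
theorem bvm_lemma_inner
    {Ω : Type*} [MeasurableSpace Ω] (P : Measure Ω) [IsProbabilityMeasure P]
    (θ₀ : ℝ) (hθ₀ : 0 < θ₀)
    (θhat : ℕ → Ω → ℝ) (hθhatMeas : ∀ N, Measurable (θhat N))
    (hcons : ∀ᵐ ω ∂P, Tendsto (fun N => θhat N ω) atTop (nhds θ₀))
    (I : ℕ → ℝ) (hIpos : ∀ N, 0 < I N) (hItop : Tendsto I atTop atTop)
    (ρ : ℝ → ℝ) (hρMeas : Measurable ρ) (hρnonneg : ∀ x, 0 ≤ ρ x)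
    (hρzero : ∀ x ≤ (0 : ℝ), ρ x = 0)
    (hρcont : ∃ ε > (0 : ℝ), (∀ x ∈ Set.Ioo (θ₀ - ε) (θ₀ + ε), 0 < ρ x) ∧
      ContinuousOn ρ (Set.Ioo (θ₀ - ε) (θ₀ + ε)))
    (f : ℝ → ℝ) (hfMeas : Measurable f) (hfnonneg : ∀ x, 0 ≤ f x)
    -- condition (C1)
    (hC1 : ∃ α : ℝ, 0 < α ∧ α < 1 ∧
      Integrable (fun x => f x * Real.exp (-(α * x ^ 2) / 2))) :
    ∃ δ₀ > (0 : ℝ), ∀ᵐ ω ∂P,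
      Tendsto (fun N => ∫ l in {l : ℝ | |l| ≤ δ₀ * Real.sqrt (I N)},
          f l * |ρ (θhat N ω + l / Real.sqrt (I N)) - ρ θ₀| * Real.exp (-(l ^ 2) / 2))
        atTop (nhds 0) := by
  obtain ⟨ε, hε, -, hcont⟩ := hρcont
  obtain ⟨α, hα₀, hα₁, hint⟩ := hC1
  have hat : ContinuousAt ρ θ₀ :=
    hcont.continuousAt (Ioo_mem_nhds (by linarith) (by linarith))
  obtain ⟨η, hη, hclose⟩ := Metric.continuousAt_iff.1 hat 1 one_pos
  refine ⟨η / 2, half_pos hη, ?_⟩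
  filter_upwards [hcons] with ω hω
  have hset (N : ℕ) : MeasurableSet {l : ℝ | |l| ≤ η / 2 * √(I N)} :=
    measurableSet_le measurable_abs measurable_const
  have hsqrt : Tendsto (fun N => √(I N)) atTop atTop := tendsto_sqrt_atTop.comp hItop
  simp_rw [← integral_indicator (hset _)]
  rw [← integral_zero ℝ ℝ (μ := volume)]
  refine tendsto_integral_filter_of_dominated_convergence
    (fun x => f x * Real.exp (-(α * x ^ 2) / 2)) (Eventually.of_forall fun N => ?_) ?_ hint
    (Eventually.of_forall fun l => ?_)
  · exact (Measurable.indicator (by fun_prop) (hset N)).aestronglyMeasurable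
  · filter_upwards [Metric.tendsto_nhds.1 hω (η / 2) (half_pos hη)] with N hN
    refine Eventually.of_forall fun l => ?_
    by_cases hl : |l| ≤ η / 2 * √(I N)
    · rw [Set.indicator_of_mem (show l ∈ {l : ℝ | |l| ≤ η / 2 * √(I N)} from hl),
        Real.norm_of_nonneg (by have := hfnonneg l; positivity)]
      have hpos : 0 < √(I N) := Real.sqrt_pos.2 (hIpos N)
      have hdiv : |l / √(I N)| ≤ η / 2 := by
        rwa [abs_div, abs_of_pos hpos, div_le_iff₀ hpos]
      have hdist : dist (θhat N ω + l / √(I N)) θ₀ < η := by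
        rw [Real.dist_eq] at hN ⊢
        calc |θhat N ω + l / √(I N) - θ₀| = |(θhat N ω - θ₀) + l / √(I N)| := by ring_nf
          _ ≤ |θhat N ω - θ₀| + |l / √(I N)| := abs_add_le _ _
          _ < η := by linarith
      have hρ : |ρ (θhat N ω + l / √(I N)) - ρ θ₀| ≤ 1 := (hclose hdist).le
      have hexp : Real.exp (-(l ^ 2) / 2) ≤ Real.exp (-(α * l ^ 2) / 2) :=
        Real.exp_le_exp.2 (by nlinarith [sq_nonneg l])
      exact mul_le_mul (mul_le_of_le_one_right (hfnonneg l) hρ) hexp (Real.exp_nonneg _)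
        (hfnonneg l)
    · rw [Set.indicator_of_notMem (show l ∉ {l : ℝ | |l| ≤ η / 2 * √(I N)} from hl), norm_zero]
      exact mul_nonneg (hfnonneg l) (Real.exp_nonneg _)
  · have harg : Tendsto (fun N => θhat N ω + l / √(I N)) atTop (nhds θ₀) := by
      simpa using hω.add (hsqrt.const_div_atTop l)
    have hlim : Tendsto (fun N => f l * |ρ (θhat N ω + l / √(I N)) - ρ θ₀| *
        Real.exp (-(l ^ 2) / 2)) atTop (nhds 0) := by
      simpa using (((hat.tendsto.comp harg).sub_const (ρ θ₀)).abs.const_mul (f l)).mul_const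
        (Real.exp (-(l ^ 2) / 2))
    refine squeeze_zero_norm (fun N => ?_) (by simpa only [norm_zero] using hlim.norm)
    exact norm_indicator_le_norm_self (fun l => f l * |ρ (θhat N ω + l / √(I N)) - ρ θ₀| *
      Real.exp (-(l ^ 2) / 2)) l
end

section
/- Suppose there exist c₁, c₂ > 0 and r ∈ (0,2) such that ϱ(θ) ≤ c₁ e^{c₂ θ^r} for all θ > 0 and f(x) ≤ c₁ e^{c₂ |x|^r} for all x ∈ ℝ. Then (C1) holds: there exists α ∈ (0,1) with ∫_ℝ f(x) e^{−α x²/2} dx < ∞; and (C2) holds: for every δ > 0, ℙ-almost surely ∫_{|λ| > δ√(I_N)} f(λ) ϱ(θ̂_N + λ/√(I_N)) e^{−λ²/2} dλ → 0 as N → ∞. -/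
open MeasureTheory Filter Real

/-- A power of order `r < 2` is dominated by an arbitrarily small multiple of the square,
up to an additive constant. -/
theorem exists_const_mul_rpow_le_add_mul_sq {r : ℝ} (hr₀ : 0 < r) (hr₂ : r < 2)
    {C ε : ℝ} (hC : 0 ≤ C) (hε : 0 < ε) :
    ∃ K : ℝ, ∀ y : ℝ, 0 ≤ y → C * y ^ r ≤ K + ε * y ^ 2 := by
  have hlim : Tendsto (fun y : ℝ => C * y ^ (-(2 - r))) atTop (nhds 0) := by
    simpa using (tendsto_rpow_neg_atTop (sub_pos.2 hr₂)).const_mul C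
  obtain ⟨Y, hY⟩ := eventually_atTop.1
    ((hlim.eventually (gt_mem_nhds hε)).and (eventually_gt_atTop 0))
  have hYpos : 0 < Y := (hY Y le_rfl).2
  refine ⟨C * Y ^ r, fun y hy => ?_⟩
  rcases le_total y Y with h | h
  · have : C * y ^ r ≤ C * Y ^ r := by gcongr
    nlinarith [mul_nonneg hε.le (sq_nonneg y)]
  · obtain ⟨h1, h2⟩ := hY y h
    have hyr : y ^ r = y ^ (-(2 - r)) * y ^ 2 := by
      rw [← rpow_natCast y 2, ← rpow_add h2]
      congr 1
      push_cast
      ring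
    have hK : 0 ≤ C * Y ^ r := by positivity
    rw [hyr, ← mul_assoc]
    nlinarith [mul_le_mul_of_nonneg_right h1.le (sq_nonneg y)]

/-- A Gaussian multiplied by a constant and an exponential constant is integrable. -/
theorem integrable_const_mul_exp_const_sub_mul_sq (c K : ℝ) {b : ℝ} (hb : 0 < b) :
    Integrable (fun x : ℝ => c * Real.exp (K - b * x ^ 2)) := by
  have h := ((integrable_exp_neg_mul_sq hb).const_mul (Real.exp K)).const_mul c
  refine h.congr (Eventually.of_forall fun x => ?_)
  simp only [← Real.exp_add]
  ring_nf



/-- If the prior `ϱ` and the test function `f` have at most exponential growth of order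
`r ∈ (0,2)`, then conditions (C1) and (C2) of the Bernstein–Von Mises theorem hold. -/
theorem exp_growth_implies_C1_C2
    {Ω : Type*} [MeasurableSpace Ω] (P : Measure Ω) [IsProbabilityMeasure P]
    (θ₀ : ℝ) (hθ₀ : 0 < θ₀)
    (θhat : ℕ → Ω → ℝ) (hθhatMeas : ∀ N, Measurable (θhat N))
    (hcons : ∀ᵐ ω ∂P, Tendsto (fun N => θhat N ω) atTop (nhds θ₀))
    (I : ℕ → ℝ) (hIpos : ∀ N, 0 < I N) (hItop : Tendsto I atTop atTop)
    (ρ : ℝ → ℝ) (hρMeas : Measurable ρ) (hρnonneg : ∀ x, 0 ≤ ρ x)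
    (hρzero : ∀ x ≤ (0 : ℝ), ρ x = 0)
    (f : ℝ → ℝ) (hfMeas : Measurable f) (hfnonneg : ∀ x, 0 ≤ f x)
    (c₁ c₂ r : ℝ) (hc₁ : 0 < c₁) (hc₂ : 0 < c₂) (hr₀ : 0 < r) (hr₂ : r < 2)
    (hρgrowth : ∀ θ : ℝ, 0 < θ → ρ θ ≤ c₁ * Real.exp (c₂ * θ ^ r))
    (hfgrowth : ∀ x : ℝ, f x ≤ c₁ * Real.exp (c₂ * |x| ^ r)) :
    -- (C1)
    (∃ α : ℝ, 0 < α ∧ α < 1 ∧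
      Integrable (fun x => f x * Real.exp (-(α * x ^ 2) / 2))) ∧
    -- (C2)
    (∀ δ > (0 : ℝ), ∀ᵐ ω ∂P,
      Tendsto (fun N => ∫ l in {l : ℝ | δ * Real.sqrt (I N) < |l|},
          f l * ρ (θhat N ω + l / Real.sqrt (I N)) * Real.exp (-(l ^ 2) / 2))
        atTop (nhds 0)) := by
  constructor
  · obtain ⟨K, hK⟩ := exists_const_mul_rpow_le_add_mul_sq hr₀ hr₂ hc₂.le
      (show (0 : ℝ) < 1 / 8 by norm_num)
    refine ⟨1 / 2, by norm_num, by norm_num, ?_⟩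
    refine (integrable_const_mul_exp_const_sub_mul_sq c₁ K
      (show (0 : ℝ) < 1 / 8 by norm_num)).mono' (by fun_prop)
      (Eventually.of_forall fun x => ?_)
    rw [Real.norm_of_nonneg (mul_nonneg (hfnonneg x) (exp_pos _).le)]
    calc f x * Real.exp (-(1 / 2 * x ^ 2) / 2)
        ≤ c₁ * Real.exp (c₂ * |x| ^ r) * Real.exp (-(1 / 2 * x ^ 2) / 2) := by
          gcongr
          exact hfgrowth x
      _ = c₁ * Real.exp (c₂ * |x| ^ r + -(1 / 2 * x ^ 2) / 2) := by
          rw [Real.exp_add, mul_assoc]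
      _ ≤ c₁ * Real.exp (K - 1 / 8 * x ^ 2) := by
          have h := hK |x| (abs_nonneg x)
          rw [sq_abs] at h
          gcongr
          linarith
  · intro δ hδ
    filter_upwards [hcons] with ω hω
    obtain ⟨K₁, hK₁⟩ := exists_const_mul_rpow_le_add_mul_sq hr₀ hr₂ hc₂.le
      (show (0 : ℝ) < 1 / 8 by norm_num)
    obtain ⟨K₂, hK₂⟩ := exists_const_mul_rpow_le_add_mul_sq hr₀ hr₂ hc₂.le
      (show (0 : ℝ) < 1 / 16 by norm_num)
    have hsqrt : Tendsto (fun N => √(I N)) atTop atTop := tendsto_sqrt_atTop.comp hItop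
    have hset : ∀ N, MeasurableSet {l : ℝ | δ * √(I N) < |l|} := fun N =>
      measurableSet_lt measurable_const measurable_id.abs
    have hρbound : ∀ θ B : ℝ, |θ| ≤ B → ρ θ ≤ c₁ * Real.exp (c₂ * B ^ r) := by
      intro θ B hB
      rcases le_or_gt θ 0 with h | h
      · rw [hρzero θ h]
        positivity
      · refine (hρgrowth θ h).trans ?_
        have : θ ≤ B := (le_abs_self θ).trans hB
        gcongr
    have hlim : Tendsto (fun N => ∫ l, {l : ℝ | δ * √(I N) < |l|}.indicator
        (fun l => f l * ρ (θhat N ω + l / √(I N)) * Real.exp (-(l ^ 2) / 2)) l)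
        atTop (nhds (∫ _ : ℝ, (0 : ℝ))) := by
      refine tendsto_integral_filter_of_dominated_convergence
        (fun l => c₁ ^ 2 * Real.exp (K₁ + K₂ + (θ₀ + 1) ^ 2 / 8 - 1 / 4 * l ^ 2))
        (Eventually.of_forall fun N => ?_) ?_
        (integrable_const_mul_exp_const_sub_mul_sq _ _ (by norm_num))
        (Eventually.of_forall fun l => ?_)
      · refine (Measurable.indicator ?_ (hset N)).aestronglyMeasurable
        fun_prop
      · filter_upwards [hω.eventually (Metric.closedBall_mem_nhds θ₀ one_pos),
          hsqrt.eventually_ge_atTop 1] with N hN hI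
        refine Eventually.of_forall fun l => ?_
        refine (norm_indicator_le_norm_self _ _).trans ?_
        rw [Real.norm_of_nonneg
          (mul_nonneg (mul_nonneg (hfnonneg _) (hρnonneg _)) (exp_pos _).le)]
        have harg : |θhat N ω + l / √(I N)| ≤ θ₀ + 1 + |l| := by
          rw [Real.dist_eq] at hN
          have h1 : |θhat N ω| ≤ θ₀ + 1 := by
            rw [abs_le] at hN ⊢
            constructor <;> linarith
          have h2 : |l / √(I N)| ≤ |l| := by
            rw [abs_div, abs_of_pos (show 0 < √(I N) by linarith)]
            exact div_le_self (abs_nonneg l) hI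
          exact (abs_add_le _ _).trans (add_le_add h1 h2)
        calc f l * ρ (θhat N ω + l / √(I N)) * Real.exp (-(l ^ 2) / 2)
            ≤ c₁ * Real.exp (c₂ * |l| ^ r) * (c₁ * Real.exp (c₂ * (θ₀ + 1 + |l|) ^ r)) *
              Real.exp (-(l ^ 2) / 2) := by
              gcongr
              · exact hρnonneg _
              · exact hfgrowth l
              · exact hρbound _ _ harg
          _ = c₁ ^ 2 * Real.exp (c₂ * |l| ^ r + c₂ * (θ₀ + 1 + |l|) ^ r + -(l ^ 2) / 2) := by
              rw [Real.exp_add, Real.exp_add]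
              ring
          _ ≤ c₁ ^ 2 * Real.exp (K₁ + K₂ + (θ₀ + 1) ^ 2 / 8 - 1 / 4 * l ^ 2) := by
              have h1 := hK₁ |l| (abs_nonneg l)
              have h2 := hK₂ (θ₀ + 1 + |l|) (by positivity)
              have h3 := sq_abs l
              gcongr
              nlinarith [sq_nonneg (θ₀ + 1 - |l|)]
      · refine tendsto_const_nhds.congr' ?_
        filter_upwards [(hsqrt.const_mul_atTop hδ).eventually_ge_atTop |l|] with N hN
        have hl : l ∉ {l : ℝ | δ * √(I N) < |l|} := not_lt.2 hN
        exact (Set.indicator_of_notMem hl _).symm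
    rw [integral_zero] at hlim
    exact hlim.congr fun N => integral_indicator (hset N)
end

section
/- (Asymptotic equivalence of the Bayesian estimator with scaled loss and the MLE.) Under the stated hypotheses, ℙ-almost surely √(I_N)·(β̃_N − θ̂_N) → 0 as N → ∞. -/
open MeasureTheory Filter Real

/-- A power of order less than two is dominated by a small multiple of the square. -/
lemma exists_mul_rpow_le_add_sq {c r : ℝ} (hc : 0 < c) (hr0 : 0 < r) (hr : r < 2) :
    ∃ C : ℝ, ∀ y : ℝ, 0 ≤ y → c * y ^ r ≤ C + y ^ 2 / 16 := by
  have h := (tendsto_rpow_neg_atTop (sub_pos.2 hr)).eventually_le_const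
    (show 0 < 1 / (16 * c) by positivity)
  obtain ⟨Y, hY⟩ := eventually_atTop.1 (h.and (eventually_gt_atTop 0))
  refine ⟨c * (max Y 0) ^ r, fun y hy => ?_⟩
  have hm : 0 ≤ c * (max Y 0) ^ r := by positivity
  rcases le_total Y y with hYy | hyY
  · obtain ⟨h1, hy0⟩ := hY y hYy
    have h2 : y ^ r = y ^ (-(2 - r)) * y ^ 2 := by
      rw [← Real.rpow_two, ← Real.rpow_add hy0]
      congr 1
      ring
    have h3 : c * y ^ r ≤ c * (1 / (16 * c) * y ^ 2) := by
      rw [h2]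
      gcongr
    have h4 : c * (1 / (16 * c) * y ^ 2) = y ^ 2 / 16 := by field_simp
    linarith
  · have : y ^ r ≤ (max Y 0) ^ r :=
      Real.rpow_le_rpow hy (hyY.trans (le_max_left _ _)) hr0.le
    nlinarith [sq_nonneg y]

/-- A function of class `exp (c |y| ^ r)`, `r < 2`, evaluated at an affinely bounded argument,
is dominated by a multiple of `exp (x ^ 2 / 8)`. -/
lemma exists_exp_mul_rpow_le {c r : ℝ} (hc : 0 < c) (hr0 : 0 < r) (hr : r < 2) (T : ℝ) :
    ∃ A > 0, ∀ x y : ℝ, |y| ≤ T + |x| → Real.exp (c * |y| ^ r) ≤ A * Real.exp (x ^ 2 / 8) := by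
  obtain ⟨C, hC⟩ := exists_mul_rpow_le_add_sq hc hr0 hr
  refine ⟨Real.exp (C + T ^ 2 / 8), Real.exp_pos _, fun x y hxy => ?_⟩
  rw [← Real.exp_add, Real.exp_le_exp]
  have h1 := hC |y| (abs_nonneg y)
  have h2 : |y| ^ 2 ≤ (T + |x|) ^ 2 := pow_le_pow_left₀ (abs_nonneg y) hxy 2
  nlinarith [sq_nonneg (T - |x|), sq_abs x]

/-- A product of two functions dominated by `exp (x ^ 2 / 8)` is dominated by a Gaussian when
weighted by `exp (-x ^ 2 / 2)`. -/
lemma norm_mul_exp_mul_le {A B p q x : ℝ} (hp : 0 ≤ p) (hq : 0 ≤ q)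
    (hpA : p ≤ A * Real.exp (x ^ 2 / 8)) (hqB : q ≤ B * Real.exp (x ^ 2 / 8)) :
    ‖p * Real.exp (-(x ^ 2) / 2) * q‖ ≤ A * B * Real.exp (-(1 / 4) * x ^ 2) := by
  rw [Real.norm_of_nonneg (by positivity)]
  have key : A * B * Real.exp (-(1 / 4) * x ^ 2) =
      (A * Real.exp (x ^ 2 / 8)) * Real.exp (-(x ^ 2) / 2) * (B * Real.exp (x ^ 2 / 8)) := by
    have : Real.exp (-(1 / 4) * x ^ 2) =
        Real.exp (x ^ 2 / 8) * Real.exp (-(x ^ 2) / 2) * Real.exp (x ^ 2 / 8) := by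
      rw [← Real.exp_add, ← Real.exp_add]; congr 1; ring
    rw [this]; ring
  rw [key]
  have := hp.trans hpA
  gcongr

/-- Convergence of Gaussian integrals weighted by a rescaled prior. -/
lemma tendsto_integral_mul_gaussian_mul_prior {ρ : ℝ → ℝ} {θ₀ : ℝ}
    (hρm : Measurable ρ) (hρ0 : ∀ x, 0 ≤ ρ x) (hρc : ContinuousAt ρ θ₀)
    (hρb : ∀ T : ℝ, ∃ B : ℝ, ∀ x y : ℝ, |y| ≤ T + |x| → ρ y ≤ B * Real.exp (x ^ 2 / 8))
    {t a : ℕ → ℝ} (ht : Tendsto t atTop (nhds θ₀)) (ha : Tendsto a atTop atTop)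
    {f : ℝ → ℝ} {A : ℝ} (hf : ∀ x, f x ≤ A * Real.exp (x ^ 2 / 8))
    {g : ℕ → ℝ → ℝ} (hgm : ∀ k, Measurable (g k)) (hg0 : ∀ k x, 0 ≤ g k x)
    (hgf : ∀ k x, g k x ≤ f x) (hlim : ∀ᵐ x, Tendsto (fun k => g k x) atTop (nhds (f x))) :
    Tendsto (fun k => ∫ x, g k x * Real.exp (-(x ^ 2) / 2) * ρ (t k + x / a k)) atTop
      (nhds ((∫ x, f x * Real.exp (-(x ^ 2) / 2)) * ρ θ₀)) := by
  obtain ⟨B, hB⟩ := hρb (|θ₀| + 1)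
  rw [← integral_mul_const]
  refine tendsto_integral_filter_of_dominated_convergence
    (fun x => A * B * Real.exp (-(1 / 4) * x ^ 2)) ?_ ?_
    ((integrable_exp_neg_mul_sq (by norm_num)).const_mul _) ?_
  · refine Eventually.of_forall fun k => Measurable.aestronglyMeasurable ?_
    have := hgm k
    fun_prop
  · filter_upwards [ha.eventually_ge_atTop 1,
      ht.abs.eventually_le_const (lt_add_one |θ₀|)] with k hak htk
    refine Eventually.of_forall fun x =>
      norm_mul_exp_mul_le (hg0 k x) (hρ0 _) ((hgf k x).trans (hf x)) (hB x _ ?_)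
    refine (abs_add_le _ _).trans (add_le_add htk ?_)
    rw [abs_div]
    exact div_le_self (abs_nonneg x) (hak.trans (le_abs_self _))
  · filter_upwards [hlim] with x hx
    refine (hx.mul_const _).mul (hρc.tendsto.comp ?_)
    simpa using ht.add (ha.const_div_atTop x)

/-- An even function that is nondecreasing on `[0, ∞)` and continuous at `0` is continuous almost
everywhere. -/
lemma ae_continuousAt_of_even_of_monotoneOn {ℓ : ℝ → ℝ} (hsymm : ∀ x, ℓ (-x) = ℓ x)
    (hmono : MonotoneOn ℓ (Set.Ici 0)) (h0 : ContinuousAt ℓ 0) :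
    ∀ᵐ x, ContinuousAt ℓ x := by
  have hm : Monotone fun x => ℓ (max x 0) := fun x y hxy =>
    hmono (Set.mem_Ici.2 (le_max_right x 0)) (Set.mem_Ici.2 (le_max_right y 0)) (max_le_max_right 0 hxy)
  have hpos : ∀ x, 0 < x → ContinuousAt (fun x => ℓ (max x 0)) x → ContinuousAt ℓ x :=
    fun x hx h => h.congr (by
      filter_upwards [lt_mem_nhds hx] with y hy
      rw [max_eq_left hy.le])
  have hD := hm.countable_not_continuousAt
  have hD' := hD.preimage (neg_injective (G := ℝ))
  filter_upwards [hD.ae_notMem volume, hD'.ae_notMem volume] with x hx hx'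
  simp only [Set.mem_preimage, Set.mem_ofPred_eq, not_not] at hx hx'
  rcases lt_trichotomy x 0 with h | rfl | h
  · have := ContinuousAt.comp (f := fun y : ℝ => -y) (x := x)
      (hpos (-x) (by linarith) hx') continuous_neg.continuousAt
    simpa [Function.comp_def, hsymm] using this
  · exact h0
  · exact hpos x h hx

/-- The posterior risk in the rescaled variable. -/
lemma setIntegral_Ioi_eq_inv_mul_integral {ℓ ρ : ℝ → ℝ} (hρ : ∀ x ≤ (0 : ℝ), ρ x = 0)
    {a : ℝ} (ha : 0 < a) (t β : ℝ) :
    (∫ η in Set.Ioi (0 : ℝ),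
        ℓ (a * (η - β)) * Real.exp (-(a ^ 2 * (η - t) ^ 2) / 2) * ρ η) =
      a⁻¹ * ∫ x, ℓ (x - a * (β - t)) * Real.exp (-(x ^ 2) / 2) * ρ (t + x / a) := by
  set F : ℝ → ℝ := fun η => ℓ (a * (η - β)) * Real.exp (-(a ^ 2 * (η - t) ^ 2) / 2) * ρ η
  have h1 : ∫ η in Set.Ioi (0 : ℝ), F η = ∫ η, F η :=
    setIntegral_eq_integral_of_forall_compl_eq_zero fun x hx => by
      simp [F, hρ x (by simpa using hx)]
  have h2 : (fun x => ℓ (x - a * (β - t)) * Real.exp (-(x ^ 2) / 2) * ρ (t + x / a)) =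
      fun x => F (t + x / a) := by
    ext x
    simp only [F]
    congr 3
    · field_simp
      ring
    · field_simp
      ring
  rw [h1, h2, Measure.integral_comp_div (fun y => F (t + y)) a,
    integral_add_left_eq_self F t, abs_of_pos ha, smul_eq_mul, inv_mul_cancel_left₀ ha.ne']

/-- An even function that is nondecreasing on `[0, ∞)` is a function of the absolute value,
monotonically. -/
lemma le_of_abs_le_of_even_of_monotoneOn {ℓ : ℝ → ℝ} (hsymm : ∀ x, ℓ (-x) = ℓ x)
    (hmono : MonotoneOn ℓ (Set.Ici 0)) {x y : ℝ} (h : |x| ≤ |y|) : ℓ x ≤ ℓ y := by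
  have habs : ∀ z, ℓ |z| = ℓ z := fun z => by
    rcases abs_choice z with hz | hz <;> rw [hz]
    exact hsymm z
  rw [← habs x, ← habs y]
  exact hmono (abs_nonneg x) (abs_nonneg y) h

/-- A real sequence staying away from `0` has a subsequence that converges to a nonzero limit or
diverges in absolute value. -/
lemma exists_subseq_tendsto_ne_zero_or_abs_atTop {u : ℕ → ℝ}
    (hu : ¬ Tendsto u atTop (nhds 0)) :
    ∃ φ : ℕ → ℕ, StrictMono φ ∧ ((∃ s ≠ 0, Tendsto (u ∘ φ) atTop (nhds s)) ∨
      Tendsto (fun k => |u (φ k)|) atTop atTop) := by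
  obtain ⟨ε, hε, hfreq⟩ : ∃ ε > 0, ∃ᶠ k in atTop, ε ≤ |u k| := by
    simp only [Metric.tendsto_nhds, not_forall, Real.dist_eq, sub_zero] at hu
    obtain ⟨ε, hε, h⟩ := hu
    exact ⟨ε, hε, by simpa [Filter.Frequently] using h⟩
  obtain ⟨φ, hφ, hφε⟩ := extraction_of_frequently_atTop hfreq
  by_cases hb : Tendsto (fun k => |u (φ k)|) atTop atTop
  · exact ⟨φ, hφ, Or.inr hb⟩
  · obtain ⟨R, hR⟩ : ∃ R, ∃ᶠ k in atTop, |u (φ k)| < R := by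
      simp only [tendsto_atTop, not_forall] at hb
      obtain ⟨R, h⟩ := hb
      exact ⟨R, by simpa [Filter.Frequently] using h⟩
    obtain ⟨s, -, ξ, hξ, hlim⟩ := tendsto_subseq_of_frequently_bounded
      (x := u ∘ φ) (Metric.isBounded_closedBall (x := (0 : ℝ)) (r := R))
      (hR.mono fun k hk => by simpa using hk.le)
    refine ⟨φ ∘ ξ, hφ.comp hξ, Or.inl ⟨s, ?_, hlim⟩⟩
    rintro rfl
    have := ge_of_tendsto' hlim.abs fun k => hφε (ξ k)
    rw [abs_zero] at this
    linarith

/-- Asymptotic equivalence of the Bayesian estimator `β̃_N` (scaled loss of class `W_{e,2}`,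
prior of class `Q_{e,2}`) with the MLE: ℙ-a.s. `√I_N (β̃_N − θ̂_N) → 0`. -/
theorem bayes_scaled_loss_equiv_mle
    {Ω : Type*} [MeasurableSpace Ω] (P : Measure Ω) [IsProbabilityMeasure P]
    (θ₀ : ℝ) (hθ₀ : 0 < θ₀)
    (θhat : ℕ → Ω → ℝ) (hθhatMeas : ∀ N, Measurable (θhat N))
    (hcons : ∀ᵐ ω ∂P, Tendsto (fun N => θhat N ω) atTop (nhds θ₀))
    (I : ℕ → ℝ) (hIpos : ∀ N, 0 < I N) (hItop : Tendsto I atTop atTop)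
    -- the loss function ℓ is of class W_{e,2}
    (ℓ : ℝ → ℝ) (hℓMeas : Measurable ℓ) (hℓnonneg : ∀ x, 0 ≤ ℓ x)
    (hℓsymm : ∀ x, ℓ (-x) = ℓ x) (hℓmono : MonotoneOn ℓ (Set.Ici 0))
    (hℓ0 : ℓ 0 = 0) (hℓcont : ContinuousAt ℓ 0) (hℓne : ∃ x, ℓ x ≠ 0)
    (hℓgrowth : ∃ c > (0 : ℝ), ∃ r : ℝ, 0 < r ∧ r < 2 ∧
      ∀ x, ℓ x ≤ Real.exp (c * |x| ^ r))
    -- the prior ϱ is of class Q_{e,2}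
    (ρ : ℝ → ℝ) (hρnonneg : ∀ x, 0 ≤ ρ x) (hρzero : ∀ x ≤ (0 : ℝ), ρ x = 0)
    (hρcont : ContinuousOn ρ (Set.Ioi 0)) (hρpos : ∀ θ : ℝ, 0 < θ → 0 < ρ θ)
    (hρgrowth : ∃ c₁ > (0 : ℝ), ∃ c₂ > (0 : ℝ), ∃ r : ℝ, 0 < r ∧ r < 2 ∧
      ∀ θ : ℝ, 0 < θ → ρ θ ≤ c₁ * Real.exp (c₂ * θ ^ r))
    -- ψ(s) := ∫ ℓ(λ+s) e^{−λ²/2} dλ has a strict minimum at s = 0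
    (hψ : ∀ s : ℝ, s ≠ 0 →
      (∫ l : ℝ, ℓ l * Real.exp (-(l ^ 2) / 2)) <
        ∫ l : ℝ, ℓ (l + s) * Real.exp (-(l ^ 2) / 2))
    -- the Bayesian estimators with respect to the scaled loss ℓ(√I_N ·)
    (βt : ℕ → Ω → ℝ) (hβtpos : ∀ N ω, 0 < βt N ω)
    (hβtmin : ∀ N ω, ∀ β : ℝ, 0 < β →
      (∫ η in Set.Ioi (0 : ℝ),
          ℓ (Real.sqrt (I N) * (η - βt N ω)) *
            Real.exp (-(I N * (η - θhat N ω) ^ 2) / 2) * ρ η) ≤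
        ∫ η in Set.Ioi (0 : ℝ),
          ℓ (Real.sqrt (I N) * (η - β)) *
            Real.exp (-(I N * (η - θhat N ω) ^ 2) / 2) * ρ η) :
    ∀ᵐ ω ∂P,
      Tendsto (fun N => Real.sqrt (I N) * (βt N ω - θhat N ω)) atTop (nhds 0) := by
  obtain ⟨c, hc, r, hr0, hr2, hℓc⟩ := hℓgrowth
  obtain ⟨c₁, hc₁, c₂, hc₂, r', hr0', hr2', hρc⟩ := hρgrowth
  have hρm : Measurable ρ := by
    have h : ρ = (Set.Ioi (0 : ℝ)).piecewise ρ fun _ => 0 := by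
      ext x
      by_cases hx : x ∈ Set.Ioi (0 : ℝ)
      · simp [hx]
      · rw [Set.piecewise_eq_of_notMem _ _ _ hx, hρzero x (by simpa using hx)]
    rw [h]
    exact hρcont.measurable_piecewise continuousOn_const measurableSet_Ioi
  have hρb : ∀ T : ℝ, ∃ B : ℝ, ∀ x y : ℝ, |y| ≤ T + |x| → ρ y ≤ B * Real.exp (x ^ 2 / 8) := by
    intro T
    obtain ⟨A, hA, h⟩ := exists_exp_mul_rpow_le hc₂ hr0' hr2' T
    refine ⟨c₁ * A, fun x y hxy => ?_⟩
    rcases le_or_gt y 0 with hy | hy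
    · rw [hρzero y hy]
      positivity
    · calc ρ y ≤ c₁ * Real.exp (c₂ * |y| ^ r') := by
            rw [abs_of_pos hy]
            exact hρc y hy
        _ ≤ c₁ * (A * Real.exp (x ^ 2 / 8)) := by
            gcongr
            exact h x y hxy
        _ = c₁ * A * Real.exp (x ^ 2 / 8) := by ring
  have hℓb : ∀ s : ℝ, ∃ A : ℝ, ∀ x : ℝ, ℓ (x - s) ≤ A * Real.exp (x ^ 2 / 8) := by
    intro s
    obtain ⟨A, -, h⟩ := exists_exp_mul_rpow_le hc hr0 hr2 |s|
    refine ⟨A, fun x => (hℓc _).trans (h x _ ?_)⟩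
    rw [add_comm]
    exact abs_sub _ _
  have hint : ∀ s t a : ℝ, 1 ≤ a →
      Integrable fun x => ℓ (x - s) * Real.exp (-(x ^ 2) / 2) * ρ (t + x / a) := by
    intro s t a ha
    obtain ⟨A, hA⟩ := hℓb s
    obtain ⟨B, hB⟩ := hρb |t|
    refine ((integrable_exp_neg_mul_sq (b := 1 / 4) (by norm_num)).const_mul (A * B)).mono'
      (Measurable.aestronglyMeasurable (by fun_prop)) (Eventually.of_forall fun x =>
        norm_mul_exp_mul_le (hℓnonneg _) (hρnonneg _) (hA x) (hB x _ ?_))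
    refine (abs_add_le _ _).trans (add_le_add_right ?_ _)
    rw [abs_div]
    exact div_le_self (abs_nonneg x) (ha.trans (le_abs_self _))
  have hρθ : ContinuousAt ρ θ₀ := hρcont.continuousAt (Ioi_mem_nhds hθ₀)
  have hsqrt : Tendsto (fun N => Real.sqrt (I N)) atTop atTop :=
    Real.tendsto_sqrt_atTop.comp hItop
  filter_upwards [hcons] with ω hω
  by_contra hcontra
  obtain ⟨φ, hφ, hsub⟩ := exists_subseq_tendsto_ne_zero_or_abs_atTop hcontra
  set a : ℕ → ℝ := fun k => Real.sqrt (I (φ k))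
  set t : ℕ → ℝ := fun k => θhat (φ k) ω
  set v : ℕ → ℝ := fun k => a k * (βt (φ k) ω - t k)
  have ha : Tendsto a atTop atTop := hsqrt.comp hφ.tendsto_atTop
  have ht : Tendsto t atTop (nhds θ₀) := hω.comp hφ.tendsto_atTop
  -- it suffices to find a nonzero shift whose loss is asymptotically below that of the estimator
  obtain ⟨s, hs, hlim⟩ : ∃ s ≠ 0, ∀ᵐ x,
      Tendsto (fun k => min (ℓ (x - v k)) (ℓ (x - s))) atTop (nhds (ℓ (x - s))) := by
    rcases hsub with ⟨s, hs, hv⟩ | hv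
    · refine ⟨s, hs, ?_⟩
      have hae := (measurePreserving_sub_right volume s).quasiMeasurePreserving.ae
        (ae_continuousAt_of_even_of_monotoneOn hℓsymm hℓmono hℓcont)
      filter_upwards [hae] with x hx
      have hxv : Tendsto (fun k => ℓ (x - v k)) atTop (nhds (ℓ (x - s))) :=
        hx.tendsto.comp (hv.const_sub x)
      simpa using hxv.min (tendsto_const_nhds (x := ℓ (x - s)))
    · refine ⟨1, one_ne_zero, Eventually.of_forall fun x => ?_⟩
      refine tendsto_const_nhds.congr' ?_
      filter_upwards [hv.eventually_ge_atTop (|x - 1| + |x|)] with k hk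
      refine (min_eq_right (le_of_abs_le_of_even_of_monotoneOn hℓsymm hℓmono ?_)).symm
      have h1 : |v k| ≤ |x - v k| + |x| := by
        simpa [abs_sub_comm] using abs_add_le (v k - x) x
      have h2 : |x - 1| + |x| ≤ |v k| := hk
      linarith
  obtain ⟨A, hA⟩ := hℓb s
  obtain ⟨A₀, hA₀⟩ := hℓb 0
  have hlower := tendsto_integral_mul_gaussian_mul_prior hρm hρnonneg hρθ hρb ht ha hA
    (g := fun k x => min (ℓ (x - v k)) (ℓ (x - s))) (fun k => by fun_prop)
    (fun k x => le_min (hℓnonneg _) (hℓnonneg _)) (fun k x => min_le_right _ _) hlim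
  have hupper := tendsto_integral_mul_gaussian_mul_prior hρm hρnonneg hρθ hρb ht ha hA₀
    (g := fun _ x => ℓ (x - 0)) (fun k => by fun_prop)
    (fun k x => hℓnonneg _) (fun k x => le_rfl) (Eventually.of_forall fun x => tendsto_const_nhds)
  have hle := le_of_tendsto_of_tendsto hlower hupper (by
    filter_upwards [ha.eventually_ge_atTop 1, ht.eventually (lt_mem_nhds hθ₀)] with k hak htk
    have ha0 : 0 < a k := by linarith
    have hmin := hβtmin (φ k) ω (t k) htk
    have hsq : I (φ k) = a k ^ 2 := (Real.sq_sqrt (hIpos _).le).symm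
    rw [show Real.sqrt (I (φ k)) = a k from rfl, show θhat (φ k) ω = t k from rfl, hsq,
      setIntegral_Ioi_eq_inv_mul_integral hρzero ha0,
      setIntegral_Ioi_eq_inv_mul_integral hρzero ha0, sub_self, mul_zero] at hmin
    refine le_trans ?_ (le_of_mul_le_mul_left hmin (inv_pos.2 ha0))
    refine integral_mono_of_nonneg (Eventually.of_forall fun x => ?_) (hint (v k) (t k) (a k) hak)
      (Eventually.of_forall fun x => ?_)
    · exact mul_nonneg (mul_nonneg (le_min (hℓnonneg _) (hℓnonneg _)) (Real.exp_pos _).le)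
        (hρnonneg _)
    · exact mul_le_mul_of_nonneg_right
        (mul_le_mul_of_nonneg_right (min_le_left _ _) (Real.exp_pos _).le) (hρnonneg _))
  have hlt := mul_lt_mul_of_pos_right (hψ (-s) (neg_ne_zero.2 hs)) (hρpos θ₀ hθ₀)
  simp only [← sub_eq_add_neg] at hlt
  simp only [sub_zero] at hle
  exact hlt.not_ge hle
end

section
/- (Uniform Bernstein–Von Mises theorem.) Suppose ϱ is continuous and strictly positive on (0,∞) with ϱ = 0 on (−∞,0], and there exist c₁, c₂ > 0 and r ∈ (0,2) such that ϱ(θ) ≤ c₁ e^{c₂ θ^r} for all θ > 0 and f(x) ≤ c₁ e^{c₂ |x|^r} for all x ∈ ℝ, where f : ℝ → [0,∞) is Borel measurable. For θ₀ > 0 set C_N^{θ₀} := ∫_ℝ ϱ(θ̂_N^{θ₀} + λ/√(I_N)) e^{−λ²/2} dλ and p̃_N^{θ₀}(λ) := (C_N^{θ₀})⁻¹ ϱ(θ̂_N^{θ₀} + λ/√(I_N)) e^{−λ²/2}. Then for every compact set B ⊂ (0,∞) and every ε > 0, sup_{θ₀ ∈ B} ℙ( ∫_ℝ f(λ)·|p̃_N^{θ₀}(λ)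 − e^{−λ²/2}/√(2π)| dλ > ε ) → 0 as N → ∞. -/
open MeasureTheory ProbabilityTheory Filter Real Topology

/-- A power of order less than `2`, shifted by a constant, is dominated by a small quadratic. -/
lemma exists_mul_add_abs_rpow_le {a A r : ℝ} (ha : 0 ≤ a) (hA : 0 ≤ A) (hr₀ : 0 < r)
    (hr₂ : r < 2) : ∃ C : ℝ, ∀ l : ℝ, a * (A + |l|) ^ r ≤ C + l ^ 2 / 4 := by
  obtain ⟨T, hT⟩ := eventually_atTop.1
    ((tendsto_rpow_atTop (sub_pos.2 hr₂)).eventually_ge_atTop (8 * a))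
  refine ⟨a * (max T 1) ^ r + A ^ 2 / 4, fun l => ?_⟩
  have hl := abs_nonneg l
  have hsq : (A + |l|) ^ 2 / 8 ≤ A ^ 2 / 4 + l ^ 2 / 4 := by
    rw [← sq_abs l]; nlinarith [sq_nonneg (A - |l|)]
  rcases le_total (A + |l|) (max T 1) with h | h
  · have : a * (A + |l|) ^ r ≤ a * (max T 1) ^ r := by gcongr
    nlinarith [sq_nonneg A, sq_nonneg l]
  · have hpos : 0 < A + |l| := by linarith [le_max_right T 1]
    have h1 := hT _ ((le_max_left _ _).trans h)
    have h2 : (A + |l|) ^ (2 - r) * (A + |l|) ^ r = (A + |l|) ^ 2 := by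
      rw [← rpow_add hpos, sub_add_cancel, rpow_two]
    have h3 : 8 * a * (A + |l|) ^ r ≤ (A + |l|) ^ 2 := by
      rw [← h2]; gcongr
    have h4 : 0 ≤ a * (max T 1) ^ r := by positivity
    linarith

/-- Subquadratic exponential growth is integrable against the Gaussian weight. -/
lemma integrable_exp_rpow_mul_exp_neg_sq {a A r : ℝ} (ha : 0 ≤ a) (hA : 0 ≤ A) (hr₀ : 0 < r)
    (hr₂ : r < 2) :
    Integrable fun l : ℝ => exp (a * (A + |l|) ^ r) * exp (-(l ^ 2) / 2) := by
  obtain ⟨C, hC⟩ := exists_mul_add_abs_rpow_le ha hA hr₀ hr₂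
  refine ((integrable_exp_neg_mul_sq (b := 1 / 4) (by norm_num)).const_mul (exp C)).mono'
    (by fun_prop) (Eventually.of_forall fun l => ?_)
  rw [norm_of_nonneg (by positivity), ← exp_add, ← exp_add]
  exact exp_le_exp.2 (by linarith [hC l])

lemma integral_exp_neg_sq_div_two : ∫ x : ℝ, exp (-(x ^ 2) / 2) = √(2 * π) := by
  have h := integral_gaussian (1 / 2)
  rw [show π / (1 / 2) = 2 * π by ring] at h
  rw [← h]
  exact integral_congr_ae (Eventually.of_forall fun x => by ring_nf)

section LocalLimit

variable {ρ f : ℝ → ℝ} {c₁ c₂ r : ℝ}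

/-- The posterior normalising constant at centre `p.1` and scale `p.2`. -/
noncomputable def posteriorMass (ρ : ℝ → ℝ) (p : ℝ × ℝ) : ℝ :=
  ∫ x : ℝ, ρ (p.1 + x * p.2) * exp (-(x ^ 2) / 2)

/-- The `f`-weighted `L¹` distance between the rescaled posterior and the Gaussian density. -/
noncomputable def posteriorDist (ρ f : ℝ → ℝ) (p : ℝ × ℝ) : ℝ :=
  ∫ l : ℝ, f l * |(posteriorMass ρ p)⁻¹ * ρ (p.1 + l * p.2) * exp (-(l ^ 2) / 2)
    - exp (-(l ^ 2) / 2) / √(2 * π)|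

lemma eventually_prior_le (hρzero : ∀ x ≤ (0 : ℝ), ρ x = 0) (hc₁ : 0 < c₁) (hc₂ : 0 < c₂)
    (hr₀ : 0 < r) (hρgrowth : ∀ θ : ℝ, 0 < θ → ρ θ ≤ c₁ * exp (c₂ * θ ^ r)) (t : ℝ) :
    ∀ᶠ p : ℝ × ℝ in 𝓝 (t, 0), ∀ l : ℝ,
      ρ (p.1 + l * p.2) ≤ c₁ * exp (c₂ * (|t| + 1 + |l|) ^ r) := by
  have h1 : ∀ᶠ p : ℝ × ℝ in 𝓝 (t, 0), |p.1| < |t| + 1 :=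
    (continuous_fst.abs.tendsto (t, (0 : ℝ))).eventually_lt_const (by simp)
  have h2 : ∀ᶠ p : ℝ × ℝ in 𝓝 (t, 0), |p.2| < 1 :=
    (continuous_snd.abs.tendsto (t, (0 : ℝ))).eventually_lt_const (by simp)
  filter_upwards [h1, h2] with p hp1 hp2 l
  rcases le_or_gt (p.1 + l * p.2) 0 with h | h
  · rw [hρzero _ h]; positivity
  · refine (hρgrowth _ h).trans ?_
    have : p.1 + l * p.2 ≤ |t| + 1 + |l| := by
      have h3 : l * p.2 ≤ |l| * 1 := by
        refine (le_abs_self _).trans ?_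
        rw [abs_mul]; gcongr
      linarith [le_abs_self p.1]
    gcongr

lemma tendsto_prior (hρcont : ContinuousOn ρ (Set.Ioi 0)) {t : ℝ} (ht : 0 < t) (l : ℝ) :
    Tendsto (fun p : ℝ × ℝ => ρ (p.1 + l * p.2)) (𝓝 (t, 0)) (𝓝 (ρ t)) := by
  have h : Tendsto (fun p : ℝ × ℝ => p.1 + l * p.2) (𝓝 (t, 0)) (𝓝 t) :=
    Continuous.tendsto' (by fun_prop) _ _ (by simp)
  exact (hρcont.continuousAt (Ioi_mem_nhds ht)).tendsto.comp h

lemma tendsto_posteriorMass (hρMeas : Measurable ρ) (hρnonneg : ∀ x, 0 ≤ ρ x)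
    (hρzero : ∀ x ≤ (0 : ℝ), ρ x = 0) (hρcont : ContinuousOn ρ (Set.Ioi 0))
    (hc₁ : 0 < c₁) (hc₂ : 0 < c₂) (hr₀ : 0 < r) (hr₂ : r < 2)
    (hρgrowth : ∀ θ : ℝ, 0 < θ → ρ θ ≤ c₁ * exp (c₂ * θ ^ r)) {t : ℝ} (ht : 0 < t) :
    Tendsto (posteriorMass ρ) (𝓝 (t, 0)) (𝓝 (ρ t * √(2 * π))) := by
  rw [← integral_exp_neg_sq_div_two, ← integral_const_mul]
  refine tendsto_integral_filter_of_dominated_convergence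
    (fun l => c₁ * (exp (c₂ * (|t| + 1 + |l|) ^ r) * exp (-(l ^ 2) / 2)))
    (Eventually.of_forall fun p => by fun_prop) ?_
    ((integrable_exp_rpow_mul_exp_neg_sq hc₂.le (by positivity) hr₀ hr₂).const_mul c₁)
    (Eventually.of_forall fun l => (tendsto_prior hρcont ht l).mul_const _)
  filter_upwards [eventually_prior_le hρzero hc₁ hc₂ hr₀ hρgrowth t] with p hp
  refine Eventually.of_forall fun l => ?_
  rw [norm_of_nonneg (mul_nonneg (hρnonneg _) (exp_pos _).le), ← mul_assoc]
  gcongr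
  exact hp l

lemma tendsto_posteriorDist (hρMeas : Measurable ρ) (hρnonneg : ∀ x, 0 ≤ ρ x)
    (hρzero : ∀ x ≤ (0 : ℝ), ρ x = 0) (hρcont : ContinuousOn ρ (Set.Ioi 0))
    (hρpos : ∀ θ : ℝ, 0 < θ → 0 < ρ θ)
    (hfMeas : Measurable f) (hfnonneg : ∀ x, 0 ≤ f x)
    (hc₁ : 0 < c₁) (hc₂ : 0 < c₂) (hr₀ : 0 < r) (hr₂ : r < 2)
    (hρgrowth : ∀ θ : ℝ, 0 < θ → ρ θ ≤ c₁ * exp (c₂ * θ ^ r))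
    (hfgrowth : ∀ x : ℝ, f x ≤ c₁ * exp (c₂ * |x| ^ r)) {t : ℝ} (ht : 0 < t) :
    Tendsto (posteriorDist ρ f) (𝓝 (t, 0)) (𝓝 0) := by
  have hρt := hρpos t ht
  have hmass : Tendsto (fun p => (posteriorMass ρ p)⁻¹) (𝓝 (t, 0))
      (𝓝 (ρ t * √(2 * π))⁻¹) :=
    (tendsto_posteriorMass hρMeas hρnonneg hρzero hρcont hc₁ hc₂ hr₀ hr₂ hρgrowth ht).inv₀
      (by positivity)
  set M := (ρ t * √(2 * π))⁻¹ + 1 with hM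
  have hMpos : 0 < M := by positivity
  set w := (√(2 * π))⁻¹ with hw
  have hwpos : 0 < w := by positivity
  have hbound : ∀ᶠ p : ℝ × ℝ in 𝓝 (t, 0), (posteriorMass ρ p)⁻¹ ≤ M :=
    hmass.eventually_le_const (by simp [hM])
  suffices h : Tendsto (posteriorDist ρ f) (𝓝 (t, 0)) (𝓝 (∫ _ : ℝ, (0 : ℝ))) by
    rwa [integral_zero] at h
  refine tendsto_integral_filter_of_dominated_convergence
    (fun l => c₁ * (M * c₁ + w) *
      (exp (2 * c₂ * (|t| + 1 + |l|) ^ r) * exp (-(l ^ 2) / 2)))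
    (Eventually.of_forall fun p => by fun_prop) ?_
    ((integrable_exp_rpow_mul_exp_neg_sq (by positivity) (by positivity) hr₀ hr₂).const_mul _)
    (Eventually.of_forall fun l => ?_)
  · filter_upwards [hbound, eventually_prior_le hρzero hc₁ hc₂ hr₀ hρgrowth t] with p hp hpρ
    refine Eventually.of_forall fun l => ?_
    have hmass0 : 0 ≤ (posteriorMass ρ p)⁻¹ :=
      inv_nonneg.2 (integral_nonneg fun x => mul_nonneg (hρnonneg _) (exp_pos _).le)
    set e := exp (-(l ^ 2) / 2)
    have he : 0 < e := exp_pos _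
    set g := exp (c₂ * (|t| + 1 + |l|) ^ r) with hg
    have hg1 : 1 ≤ g := one_le_exp (by positivity)
    have hfg : f l ≤ c₁ * g := by
      refine (hfgrowth l).trans ?_
      have : |l| ≤ |t| + 1 + |l| := by linarith [abs_nonneg t]
      rw [hg]
      gcongr
    have hgg : exp (2 * c₂ * (|t| + 1 + |l|) ^ r) = g * g := by
      rw [hg, ← exp_add]; ring_nf
    have hρl := hρnonneg (p.1 + l * p.2)
    have hdiff : |(posteriorMass ρ p)⁻¹ * ρ (p.1 + l * p.2) * e - e / √(2 * π)|
        ≤ (M * c₁ + w) * g * e := by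
      have h1 : (posteriorMass ρ p)⁻¹ * ρ (p.1 + l * p.2) * e ≤ M * (c₁ * g) * e := by
        gcongr
        exact hpρ l
      have h2 : e / √(2 * π) ≤ w * g * e := by
        rw [div_eq_mul_inv, ← hw]
        nlinarith [mul_pos hwpos he]
      have h3 : 0 ≤ (posteriorMass ρ p)⁻¹ * ρ (p.1 + l * p.2) * e := by positivity
      have h4 : 0 ≤ e / √(2 * π) := by positivity
      rw [abs_le]
      have h5 : (M * c₁ + w) * g * e = M * (c₁ * g) * e + w * g * e := by ring
      constructor <;> linarith
    rw [norm_of_nonneg (mul_nonneg (hfnonneg l) (abs_nonneg _)), hgg]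
    calc f l * |(posteriorMass ρ p)⁻¹ * ρ (p.1 + l * p.2) * e - e / √(2 * π)|
        ≤ c₁ * g * ((M * c₁ + w) * g * e) := by gcongr
      _ = c₁ * (M * c₁ + w) * (g * g * e) := by ring
  · have h := ((((hmass.mul (tendsto_prior hρcont ht l)).mul_const (exp (-(l ^ 2) / 2))).sub_const
      (exp (-(l ^ 2) / 2) / √(2 * π))).abs).const_mul (f l)
    have hlim : (ρ t * √(2 * π))⁻¹ * ρ t * exp (-(l ^ 2) / 2)
        - exp (-(l ^ 2) / 2) / √(2 * π) = 0 := by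
      field_simp
      simp
    rw [hlim, abs_zero, mul_zero] at h
    exact h

end LocalLimit

/-- Uniform Bernstein–Von Mises theorem: for priors and test functions of at most
exponential growth, the posterior density of `√I_N (Θ − θ̂_N^{θ₀})` converges to the
standard Gaussian density in `f`-weighted `L¹`, in probability, uniformly in `θ₀` over
compact subsets of `(0,∞)`. -/
theorem uniform_bernstein_von_mises
    {Ω : Type*} [MeasurableSpace Ω] (P : Measure Ω) [IsProbabilityMeasure P]
    (ξ : ℕ → Ω → ℝ) (hξMeas : ∀ N, Measurable (ξ N))
    (hξGauss : ∀ N, Measure.map (ξ N) P = gaussianReal 0 1)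
    (I : ℕ → ℝ) (hIpos : ∀ N, 0 < I N) (hItop : Tendsto I atTop atTop)
    (ρ : ℝ → ℝ) (hρMeas : Measurable ρ) (hρnonneg : ∀ x, 0 ≤ ρ x)
    (hρzero : ∀ x ≤ (0 : ℝ), ρ x = 0)
    (hρcont : ContinuousOn ρ (Set.Ioi 0)) (hρpos : ∀ θ : ℝ, 0 < θ → 0 < ρ θ)
    (f : ℝ → ℝ) (hfMeas : Measurable f) (hfnonneg : ∀ x, 0 ≤ f x)
    (c₁ c₂ r : ℝ) (hc₁ : 0 < c₁) (hc₂ : 0 < c₂) (hr₀ : 0 < r) (hr₂ : r < 2)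
    (hρgrowth : ∀ θ : ℝ, 0 < θ → ρ θ ≤ c₁ * Real.exp (c₂ * θ ^ r))
    (hfgrowth : ∀ x : ℝ, f x ≤ c₁ * Real.exp (c₂ * |x| ^ r)) :
    ∀ B : Set ℝ, IsCompact B → B ⊆ Set.Ioi 0 → ∀ ε > (0 : ℝ),
      Tendsto (fun N => ⨆ θ₀ ∈ B,
          P {ω : Ω |
            ε < ∫ l : ℝ,
              f l * |(∫ x : ℝ, ρ (θ₀ + ξ N ω / Real.sqrt (I N) + x / Real.sqrt (I N))
                        * Real.exp (-(x ^ 2) / 2))⁻¹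
                      * ρ (θ₀ + ξ N ω / Real.sqrt (I N) + l / Real.sqrt (I N))
                      * Real.exp (-(l ^ 2) / 2)
                    - Real.exp (-(l ^ 2) / 2) / Real.sqrt (2 * π)|})
        atTop (nhds 0) := by
  intro B hB hBpos ε hε
  have hscale : Tendsto (fun N => (√(I N))⁻¹) atTop (𝓝 0) :=
    (tendsto_sqrt_atTop.comp hItop).inv_tendsto_atTop
  rw [ENNReal.tendsto_nhds_zero]
  intro δ hδ
  obtain ⟨K, -, hK, hKδ⟩ := MeasurableSet.univ.exists_isCompact_sdiff_lt
    (μ := gaussianReal 0 1) (measure_ne_top _ _) hδ.ne'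
  have hsmall : ∀ᶠ s in 𝓝 (0 : ℝ), ∀ y ∈ B ×ˢ K,
      posteriorDist ρ f (y.1 + y.2 * s, s) < ε := by
    refine (hB.prod hK).eventually_forall_of_forall_eventually fun y hy => ?_
    have hcont : Tendsto (fun q : ℝ × (ℝ × ℝ) => (q.2.1 + q.2.2 * q.1, q.1))
        (𝓝 (0, y)) (𝓝 (y.1, (0 : ℝ))) :=
      Continuous.tendsto' (by fun_prop) _ _ (by simp)
    exact ((tendsto_posteriorDist hρMeas hρnonneg hρzero hρcont hρpos hfMeas hfnonneg
      hc₁ hc₂ hr₀ hr₂ hρgrowth hfgrowth (hBpos hy.1)).comp hcont).eventually_lt_const hε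
  filter_upwards [hscale.eventually hsmall] with N hN
  refine iSup₂_le fun θ₀ hθ₀ => ?_
  have hsub : {ω : Ω | ε < posteriorDist ρ f (θ₀ + ξ N ω * (√(I N))⁻¹, (√(I N))⁻¹)}
      ⊆ ξ N ⁻¹' (Set.univ \ K) := fun ω hω =>
    ⟨trivial, fun hmem => lt_asymm hω (hN (θ₀, ξ N ω) ⟨hθ₀, hmem⟩)⟩
  have hle := (measure_mono hsub).trans_eq
    (Measure.map_apply (μ := P) (hξMeas N) (MeasurableSet.univ.diff hK.measurableSet)).symm
  rw [hξGauss N] at hle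
  simp only [posteriorDist, posteriorMass, ← div_eq_mul_inv] at hle
  exact hle.trans hKδ.le
end

section
/- Suppose ϱ is continuous and strictly positive on (0,∞) with ϱ = 0 on (−∞,0], and there exist c₁, c₂ > 0 and r ∈ (0,2) such that ϱ(θ) ≤ c₁ e^{c₂ θ^r} for all θ > 0 and f(x) ≤ c₁ e^{c₂ |x|^r} for all x ∈ ℝ, where f : ℝ → [0,∞) is Borel measurable. Then for every compact set B ⊂ (0,∞) there exists δ₀ > 0 such that for every ε > 0, sup_{θ₀ ∈ B} ℙ( ∫_{|λ| ≤ δ₀√(I_N)} f(λ)·|ϱ(θ̂_N^{θ₀} + λ/√(I_N)) − ϱ(θ₀)|·e^{−λ²/2} dλ > ε ) → 0 as N → ∞. -/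
open MeasureTheory ProbabilityTheory Filter Real

/-- On a compact set a continuous function is Lipschitz up to an arbitrarily small error. -/
theorem IsCompact.exists_dist_le_add_mul_dist {ρ : ℝ → ℝ} {K : Set ℝ} (hK : IsCompact K)
    (hρ : ContinuousOn ρ K) {η : ℝ} (hη : 0 < η) :
    ∃ C ≥ (0 : ℝ), ∀ x ∈ K, ∀ y ∈ K, |ρ x - ρ y| ≤ η + C * |x - y| := by
  obtain ⟨M, hM⟩ := hK.exists_bound_of_continuousOn hρ
  obtain ⟨d, hd, hdist⟩ := Metric.uniformContinuousOn_iff.1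
    (hK.uniformContinuousOn_of_continuous hρ) η hη
  refine ⟨2 * |M| / d, by positivity, fun x hx y hy => ?_⟩
  rcases lt_or_ge |x - y| d with h | h
  · have h1 : |ρ x - ρ y| < η := hdist x hx y hy h
    have h2 : 0 ≤ 2 * |M| / d * |x - y| := by positivity
    linarith
  · have h1 : |ρ x - ρ y| ≤ |ρ x| + |ρ y| := abs_sub _ _
    have h2 := hM x hx
    have h3 := hM y hy
    rw [Real.norm_eq_abs] at h2 h3
    have h4 : 2 * |M| ≤ 2 * |M| / d * |x - y| := by
      rw [div_mul_eq_mul_div, le_div_iff₀ hd]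
      gcongr
    linarith [le_abs_self M]

/-- A power of exponent less than two is bounded by a small multiple of the square plus a
constant. -/
theorem exists_mul_rpow_le_add_sq_s17 (c : ℝ) {r κ : ℝ} (hr₀ : 0 < r) (hr₂ : r < 2) (hκ : 0 < κ) :
    ∃ D : ℝ, ∀ t : ℝ, 0 ≤ t → c * t ^ r ≤ D + κ * t ^ 2 := by
  have h : Tendsto (fun t : ℝ => c * t ^ (-(2 - r))) atTop (nhds 0) := by
    simpa using (tendsto_rpow_neg_atTop (sub_pos.2 hr₂)).const_mul c
  obtain ⟨T, hT⟩ := eventually_atTop.1 (h.eventually_le_const hκ)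
  refine ⟨|c| * |T| ^ r, fun t ht => ?_⟩
  have h0 : 0 ≤ |c| * |T| ^ r := by positivity
  rcases le_total T t with hTt | hTt
  · rcases ht.eq_or_lt with rfl | ht
    · simpa [Real.zero_rpow hr₀.ne'] using h0
    have h1 : t ^ r = t ^ (-(2 - r)) * t ^ 2 := by
      rw [← Real.rpow_two, ← Real.rpow_add ht]
      ring_nf
    rw [h1, ← mul_assoc]
    have h2 := mul_le_mul_of_nonneg_right (hT t hTt) (sq_nonneg t)
    linarith
  · have h1 : t ^ r ≤ |T| ^ r := Real.rpow_le_rpow ht (hTt.trans (le_abs_self T)) hr₀.le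
    have h2 : c * t ^ r ≤ |c| * |T| ^ r := by
      gcongr
      exact le_abs_self c
    nlinarith [sq_nonneg t]

/-- A function of growth `exp (c₂ |x| ^ r)` with `r < 2` has an integrable first absolute moment
against the Gaussian weight. -/
theorem integrable_one_add_abs_mul_mul_exp_neg_sq {f : ℝ → ℝ} (hfMeas : Measurable f)
    (hfnonneg : ∀ x, 0 ≤ f x) {c₁ c₂ r : ℝ} (hc₁ : 0 < c₁) (hr₀ : 0 < r) (hr₂ : r < 2)
    (hfgrowth : ∀ x : ℝ, f x ≤ c₁ * Real.exp (c₂ * |x| ^ r)) :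
    Integrable fun l : ℝ => (1 + |l|) * (f l * Real.exp (-(l ^ 2) / 2)) := by
  obtain ⟨D, hD⟩ := exists_mul_rpow_le_add_sq_s17 c₂ hr₀ hr₂ (κ := 1 / 8) (by norm_num)
  have hg : Integrable fun l : ℝ => 4 * c₁ * Real.exp D * Real.exp (-(1 / 4) * l ^ 2) :=
    (integrable_exp_neg_mul_sq (by norm_num)).const_mul _
  refine hg.mono' (by fun_prop) (Eventually.of_forall fun l => ?_)
  have hf := hfnonneg l
  rw [Real.norm_eq_abs, abs_of_nonneg (by positivity)]
  have h1 : 1 + |l| ≤ 4 * Real.exp (1 / 8 * l ^ 2) := by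
    have h := Real.add_one_le_exp (1 / 8 * l ^ 2)
    nlinarith [sq_nonneg (|l| - 1), sq_abs l]
  have h2 : f l ≤ c₁ * Real.exp (D + 1 / 8 * l ^ 2) := by
    refine (hfgrowth l).trans ?_
    gcongr
    simpa using hD |l| (abs_nonneg l)
  calc (1 + |l|) * (f l * Real.exp (-(l ^ 2) / 2))
      ≤ 4 * Real.exp (1 / 8 * l ^ 2)
          * (c₁ * Real.exp (D + 1 / 8 * l ^ 2) * Real.exp (-(l ^ 2) / 2)) := by gcongr
    _ = 4 * c₁ * (Real.exp (1 / 8 * l ^ 2)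
          * Real.exp (D + 1 / 8 * l ^ 2) * Real.exp (-(l ^ 2) / 2)) := by ring
    _ = 4 * c₁ * Real.exp D * Real.exp (-(1 / 4) * l ^ 2) := by
      rw [mul_assoc (4 * c₁), ← Real.exp_add, ← Real.exp_add, ← Real.exp_add]
      ring_nf

/-- The tails of a finite measure on `ℝ` vanish. -/
theorem tendsto_measure_lt_abs_atTop (μ : Measure ℝ) [IsFiniteMeasure μ] :
    Tendsto (fun t : ℝ => μ {x | t < |x|}) atTop (nhds 0) := by
  have h : ⋂ t : ℝ, {x : ℝ | t < |x|} = ∅ := by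
    ext x
    simp only [Set.mem_iInter, Set.mem_ofPred_eq, Set.mem_empty_iff_false, iff_false, not_forall]
    exact ⟨|x|, lt_irrefl _⟩
  rw [← measure_empty (μ := μ), ← h]
  refine tendsto_measure_iInter_atTop
    (fun t => (measurableSet_lt measurable_const measurable_abs).nullMeasurableSet)
    (fun s t hst x hx => lt_of_le_of_lt hst hx) ⟨0, measure_ne_top μ _⟩

/-- If `ρ` is Lipschitz on `K` up to the error `η`, then the Gaussian-weighted oscillation of `ρ`
around `θ` is controlled, as long as the arguments remain in `K`. -/
theorem setIntegral_mul_abs_sub_mul_exp_le {f ρ : ℝ → ℝ} (hfnonneg : ∀ x, 0 ≤ f x)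
    (hint : Integrable fun l : ℝ => (1 + |l|) * (f l * Real.exp (-(l ^ 2) / 2)))
    {η C s θ x : ℝ} {S K : Set ℝ} (hS : MeasurableSet S) (hη : 0 < η) (hC : 0 ≤ C) (hs : 0 < s)
    (hK : ∀ y ∈ K, |ρ y - ρ θ| ≤ η + C * |y - θ|)
    (hmem : ∀ l ∈ S, θ + x / s + l / s ∈ K) :
    ∫ l in S, f l * |ρ (θ + x / s + l / s) - ρ θ| * Real.exp (-(l ^ 2) / 2)
      ≤ (η + C * (|x| + 1) / s) * ∫ l, (1 + |l|) * (f l * Real.exp (-(l ^ 2) / 2)) := by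
  have hnonneg : ∀ l : ℝ, 0 ≤ (1 + |l|) * (f l * Real.exp (-(l ^ 2) / 2)) := fun l => by
    have := hfnonneg l
    positivity
  rw [← integral_const_mul]
  refine (integral_mono_of_nonneg (Eventually.of_forall fun l => ?_)
    (hint.const_mul (η + C * (|x| + 1) / s)).integrableOn
    (ae_restrict_of_forall_mem hS fun l hl => ?_)).trans
    (setIntegral_le_integral (hint.const_mul _) (Eventually.of_forall fun l => ?_))
  · have := hfnonneg l
    simp only [Pi.zero_apply]
    positivity
  · have hf := hfnonneg l
    have h1 : |θ + x / s + l / s - θ| ≤ (|x| + |l|) / s := by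
      rw [show θ + x / s + l / s - θ = (x + l) / s by ring, abs_div, abs_of_pos hs]
      gcongr
      exact abs_add_le x l
    have h2 : |ρ (θ + x / s + l / s) - ρ θ| ≤ (η + C * (|x| + 1) / s) * (1 + |l|) := by
      calc |ρ (θ + x / s + l / s) - ρ θ| ≤ η + C * ((|x| + |l|) / s) :=
            (hK _ (hmem l hl)).trans (by gcongr)
        _ ≤ η + C * ((|x| + |l|) / s) + (η * |l| + C * (1 + |x| * |l|) / s) :=
            le_add_of_nonneg_right (by positivity)
        _ = (η + C * (|x| + 1) / s) * (1 + |l|) := by ring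
    calc f l * |ρ (θ + x / s + l / s) - ρ θ| * Real.exp (-(l ^ 2) / 2)
        ≤ f l * ((η + C * (|x| + 1) / s) * (1 + |l|)) * Real.exp (-(l ^ 2) / 2) := by gcongr
      _ = _ := by ring
  · have := hnonneg l
    simp only [Pi.zero_apply]
    positivity

/-- Uniform version (inner region) of the key Bernstein–Von Mises lemma: for priors and test
functions of at most exponential growth, the weighted integral over `{|λ| ≤ δ₀ √I_N}` of
`f(λ)|ϱ(θ̂_N^{θ₀} + λ/√I_N) − ϱ(θ₀)| e^{−λ²/2}` tends to `0` in probability, uniformly in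
`θ₀` over compact subsets of `(0,∞)`. -/
theorem uniform_bvm_lemma_inner
    {Ω : Type*} [MeasurableSpace Ω] (P : Measure Ω) [IsProbabilityMeasure P]
    (ξ : ℕ → Ω → ℝ) (hξMeas : ∀ N, Measurable (ξ N))
    (hξGauss : ∀ N, Measure.map (ξ N) P = gaussianReal 0 1)
    (I : ℕ → ℝ) (hIpos : ∀ N, 0 < I N) (hItop : Tendsto I atTop atTop)
    (ρ : ℝ → ℝ) (hρMeas : Measurable ρ) (hρnonneg : ∀ x, 0 ≤ ρ x)
    (hρzero : ∀ x ≤ (0 : ℝ), ρ x = 0)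
    (hρcont : ContinuousOn ρ (Set.Ioi 0)) (hρpos : ∀ θ : ℝ, 0 < θ → 0 < ρ θ)
    (f : ℝ → ℝ) (hfMeas : Measurable f) (hfnonneg : ∀ x, 0 ≤ f x)
    (c₁ c₂ r : ℝ) (hc₁ : 0 < c₁) (hc₂ : 0 < c₂) (hr₀ : 0 < r) (hr₂ : r < 2)
    (hρgrowth : ∀ θ : ℝ, 0 < θ → ρ θ ≤ c₁ * Real.exp (c₂ * θ ^ r))
    (hfgrowth : ∀ x : ℝ, f x ≤ c₁ * Real.exp (c₂ * |x| ^ r)) :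
    ∀ B : Set ℝ, IsCompact B → B ⊆ Set.Ioi 0 →
      ∃ δ₀ > (0 : ℝ), ∀ ε > (0 : ℝ),
        Tendsto (fun N => ⨆ θ₀ ∈ B,
            P {ω : Ω |
              ε < ∫ l in {l : ℝ | |l| ≤ δ₀ * Real.sqrt (I N)},
                f l * |ρ (θ₀ + ξ N ω / Real.sqrt (I N) + l / Real.sqrt (I N)) - ρ θ₀|
                  * Real.exp (-(l ^ 2) / 2)})
          atTop (nhds 0) := by
  intro B hB hBpos
  obtain ⟨d, hd, hdB⟩ := hB.exists_cthickening_subset_open isOpen_Ioi hBpos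
  set K := Metric.cthickening d B
  have hK : IsCompact K := hB.cthickening
  refine ⟨d / 2, by positivity, fun ε hε => ?_⟩
  have hint := integrable_one_add_abs_mul_mul_exp_neg_sq hfMeas hfnonneg hc₁ hr₀ hr₂ hfgrowth
  set A := ∫ l : ℝ, (1 + |l|) * (f l * Real.exp (-(l ^ 2) / 2))
  have hA : 0 ≤ A := integral_nonneg fun l => by
    have := hfnonneg l
    simp only [Pi.zero_apply]
    positivity
  obtain ⟨C, hC, hρK⟩ := hK.exists_dist_le_add_mul_dist (hρcont.mono hdB)
    (η := ε / (3 * (A + 1))) (by positivity)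
  set κ := min (d / 2) (ε / (3 * ((C + 1) * (A + 1))))
  have hκ : 0 < κ := lt_min (by positivity) (by positivity)
  have hsqrt : Tendsto (fun N => κ * Real.sqrt (I N)) atTop atTop :=
    (Real.tendsto_sqrt_atTop.comp hItop).const_mul_atTop hκ
  refine tendsto_of_tendsto_of_tendsto_of_le_of_le' tendsto_const_nhds
    ((tendsto_measure_lt_abs_atTop (gaussianReal 0 1)).comp hsqrt)
    (Eventually.of_forall fun N => zero_le) ?_
  filter_upwards [hsqrt.eventually_ge_atTop 1] with N hN
  refine iSup₂_le fun θ hθ => ?_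
  have htail : gaussianReal 0 1 {x | κ * Real.sqrt (I N) < |x|}
      = P {ω | κ * Real.sqrt (I N) < |ξ N ω|} := by
    rw [← hξGauss N, Measure.map_apply (hξMeas N)
      (measurableSet_lt measurable_const measurable_abs)]
    rfl
  rw [Function.comp_apply, htail]
  refine measure_mono fun ω hω => ?_
  rw [Set.mem_ofPred_eq] at hω ⊢
  by_contra! hξ
  have hs : 0 < Real.sqrt (I N) := Real.sqrt_pos.2 (hIpos N)
  set s := Real.sqrt (I N)
  have hθK : θ ∈ K := Metric.self_subset_cthickening B hθ
  have hmem : ∀ l ∈ {l : ℝ | |l| ≤ d / 2 * s}, θ + ξ N ω / s + l / s ∈ K := fun l hl => by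
    refine Metric.mem_cthickening_of_dist_le _ θ d B hθ ?_
    rw [Real.dist_eq, show θ + ξ N ω / s + l / s - θ = (ξ N ω + l) / s by ring, abs_div,
      abs_of_pos hs, div_le_iff₀ hs]
    have h1 : κ * s ≤ d / 2 * s := by
      gcongr
      exact min_le_left _ _
    have h2 : |l| ≤ d / 2 * s := hl
    linarith [abs_add_le (ξ N ω) l]
  have hbound := setIntegral_mul_abs_sub_mul_exp_le hfnonneg hint
    (measurableSet_le measurable_abs measurable_const) (by positivity) hC hs
    (fun y hy => hρK y hy θ hθK) hmem
  have h1 : C * (|ξ N ω| + 1) / s ≤ 2 * (ε / (3 * (A + 1))) := by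
    calc C * (|ξ N ω| + 1) / s ≤ (C + 1) * (κ * s + κ * s) / s := by
          gcongr
          linarith
      _ = 2 * ((C + 1) * κ) := by
          field_simp
          ring
      _ ≤ 2 * ((C + 1) * (ε / (3 * ((C + 1) * (A + 1))))) := by
          gcongr
          exact min_le_right _ _
      _ = 2 * (ε / (3 * (A + 1))) := by field_simp
  have h2 : (ε / (3 * (A + 1)) + C * (|ξ N ω| + 1) / s) * A ≤ ε := by
    calc (ε / (3 * (A + 1)) + C * (|ξ N ω| + 1) / s) * A
        ≤ (ε / (3 * (A + 1)) + 2 * (ε / (3 * (A + 1)))) * (A + 1) := by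
          gcongr
          linarith
      _ = ε := by
          field_simp
          ring
  exact absurd (hω.trans_le (hbound.trans h2)) (lt_irrefl ε)
end

section
/- (Uniform asymptotic equivalence in probability of the Bayesian estimator with scaled loss and the MLE.) Under the stated hypotheses, for every compact set B ⊂ (0,∞) and every ε > 0, sup_{θ₀ ∈ B} ℙ( √(I_N)·|β̃_N^{θ₀} − θ̂_N^{θ₀}| > ε ) → 0 as N → ∞. -/
open MeasureTheory ProbabilityTheory Filter Real

/-- A subquadratic power is bounded by a small multiple of the square plus a constant. -/
lemma exists_mul_rpow_le_add_mul_sq {c r δ : ℝ} (hc : 0 < c) (hr : 0 < r) (hr2 : r < 2)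
    (hδ : 0 < δ) : ∃ C, ∀ y : ℝ, 0 ≤ y → c * y ^ r ≤ C + δ * y ^ 2 := by
  have hr' : 0 < 2 - r := by linarith
  refine ⟨c * ((c / δ) ^ (1 / (2 - r))) ^ r, fun y hy => ?_⟩
  have hcδ : 0 < c / δ := by positivity
  rcases le_total y ((c / δ) ^ (1 / (2 - r))) with h | h
  · have : y ^ r ≤ ((c / δ) ^ (1 / (2 - r))) ^ r := rpow_le_rpow hy h hr.le
    have := mul_le_mul_of_nonneg_left this hc.le
    nlinarith [mul_nonneg hδ.le (sq_nonneg y)]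
  · have hy' : 0 < y := lt_of_lt_of_le (by positivity) h
    have h1 : c / δ ≤ y ^ (2 - r) := by
      have := rpow_le_rpow (by positivity) h hr'.le
      rwa [← rpow_mul hcδ.le, one_div, inv_mul_cancel₀ hr'.ne', rpow_one] at this
    have h2 : y ^ (2 - r) * y ^ r = y ^ 2 := by
      rw [← rpow_add hy', ← rpow_natCast]; norm_num
    have h3 : c ≤ y ^ (2 - r) * δ := by rwa [div_le_iff₀ hδ] at h1
    have h4 : c * y ^ r ≤ δ * y ^ 2 := by
      rw [← h2]
      have := mul_le_mul_of_nonneg_right h3 (rpow_nonneg hy r)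
      linarith
    have : 0 ≤ c * ((c / δ) ^ (1 / (2 - r))) ^ r := by positivity
    linarith

/-- One-dimensional Anderson inequality: integrating an even, radially nondecreasing function
against an even, radially nonincreasing weight gives a radially nondecreasing function of the
shift. -/
lemma integral_shift_mul_le_of_abs_le {f g : ℝ → ℝ}
    (hf : ∀ x y, |x| ≤ |y| → f x ≤ f y) (hg : ∀ x y, |x| ≤ |y| → g y ≤ g x)
    (hint : ∀ s, Integrable fun x => f (x + s) * g x) {a b : ℝ} (hab : |a| ≤ |b|) :
    ∫ x, f (x + a) * g x ≤ ∫ x, f (x + b) * g x := by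
  have hgsymm : ∀ x, g (-x) = g x := fun x =>
    le_antisymm (hg _ _ (abs_neg x).symm.le) (hg _ _ (abs_neg x).le)
  have shift : ∀ s, (fun x => f x * g (x - s)) = fun x => (fun y => f (y + s) * g y) (x - s) := by
    intro s; ext x; simp
  have refl : ∀ s, (fun x => f (a + b - x) * g (x - (a + b - s)))
      = fun x => (fun y => f (y + s) * g y) ((a + b - s) - x) := by
    intro s; ext x
    change _ = f (a + b - s - x + s) * g (a + b - s - x)
    rw [← hgsymm (a + b - s - x)]; congr 2 <;> ring
  have i1 : ∀ s, Integrable fun x => f x * g (x - s) := by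
    intro s; rw [shift]; exact (hint s).comp_sub_right s
  have i2 : ∀ s, Integrable fun x => f (a + b - x) * g (x - (a + b - s)) := by
    intro s; rw [refl]; exact (hint s).comp_sub_left _
  have e1 : ∀ s, ∫ x, f x * g (x - s) = ∫ x, f (x + s) * g x := by
    intro s; rw [shift]; exact integral_sub_right_eq_self (fun y => f (y + s) * g y) s
  have e2 : ∀ s, ∫ x, f (a + b - x) * g (x - (a + b - s)) = ∫ x, f (x + s) * g x := by
    intro s; rw [refl]; exact integral_sub_left_eq_self (fun y => f (y + s) * g y) volume _
  have i2a := i2 a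
  have i2b := i2 b
  have e2a := e2 a
  have e2b := e2 b
  rw [add_sub_cancel_left] at i2a e2a
  rw [add_sub_cancel_right] at i2b e2b
  have key : 0 ≤ ∫ x, ((f x * g (x - b) - f x * g (x - a))
      - (f (a + b - x) * g (x - b) - f (a + b - x) * g (x - a))) := by
    refine integral_nonneg fun x => ?_
    have h : 0 ≤ (x ^ 2 - (a + b - x) ^ 2) * ((x - a) ^ 2 - (x - b) ^ 2) := by
      have : 0 ≤ (b ^ 2 - a ^ 2) * (2 * x - a - b) ^ 2 :=
        mul_nonneg (sub_nonneg.2 (sq_le_sq.2 hab)) (sq_nonneg _)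
      nlinarith
    have h' : 0 ≤ (f x - f (a + b - x)) * (g (x - b) - g (x - a)) := by
      rcases mul_nonneg_iff.1 h with ⟨h1, h2⟩ | ⟨h1, h2⟩
      · exact mul_nonneg (sub_nonneg.2 (hf _ _ (sq_le_sq.1 (sub_nonneg.1 h1))))
          (sub_nonneg.2 (hg _ _ (sq_le_sq.1 (sub_nonneg.1 h2))))
      · exact mul_nonneg_of_nonpos_of_nonpos
          (sub_nonpos.2 (hf _ _ (sq_le_sq.1 (sub_nonpos.1 h1))))
          (sub_nonpos.2 (hg _ _ (sq_le_sq.1 (sub_nonpos.1 h2))))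
    simp only [Pi.zero_apply]
    nlinarith
  have j1 : Integrable fun x => f x * g (x - b) - f x * g (x - a) := (i1 b).sub (i1 a)
  have j2 : Integrable fun x => f (a + b - x) * g (x - b) - f (a + b - x) * g (x - a) :=
    i2a.sub i2b
  rw [integral_sub j1 j2, integral_sub (i1 b) (i1 a), integral_sub i2a i2b, e1, e1, e2a, e2b] at key
  linarith

/-- Rescaling around `t`: the posterior risk in local coordinates. -/
lemma setIntegral_Ioi_eq_inv_mul_integral_rescaled {ℓ ρ : ℝ → ℝ}
    (hρzero : ∀ x ≤ (0 : ℝ), ρ x = 0) {J : ℝ} (hJ : 0 < J) (t β : ℝ) :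
    ∫ η in Set.Ioi (0 : ℝ), ℓ (√J * (η - β)) * exp (-(J * (η - t) ^ 2) / 2) * ρ η
      = (√J)⁻¹ * ∫ l, ℓ (l + √J * (t - β)) * exp (-(l ^ 2) / 2) * ρ (t + l / √J) := by
  have hk : 0 < √J := sqrt_pos.2 hJ
  rw [setIntegral_eq_integral_of_forall_compl_eq_zero
    (fun x hx => by rw [hρzero x (not_lt.1 hx), mul_zero])]
  set F : ℝ → ℝ := fun η => ℓ (√J * (η - β)) * exp (-(J * (η - t) ^ 2) / 2) * ρ η with hF
  have h1 : (fun l => ℓ (l + √J * (t - β)) * exp (-(l ^ 2) / 2) * ρ (t + l / √J))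
      = fun l => (fun y => F (t + y)) (l / √J) := by
    ext l
    simp only [hF]
    congr 3
    · field_simp; ring
    · have : J * (t + l / √J - t) ^ 2 = l ^ 2 := by
        rw [add_sub_cancel_left, div_pow, sq_sqrt hJ.le]; field_simp
      rw [this]
  rw [h1, Measure.integral_comp_div (fun y => F (t + y)), integral_add_left_eq_self F t, abs_of_pos hk, smul_eq_mul,
    inv_mul_cancel_left₀ hk.ne']

/-- An integrand with two factors of growth at most `exp (x² / 16)` is dominated by a Gaussian. -/
lemma exp_mul_exp_mul_exp_le {s t k l T : ℝ} (hk : 1 ≤ k) (ht : |t| ≤ T) :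
    exp ((l + s) ^ 2 / 16) * exp (-(l ^ 2) / 2) * exp ((t + l / k) ^ 2 / 16)
      ≤ exp ((s ^ 2 + T ^ 2) / 8) * exp (-(1 / 4) * l ^ 2) := by
  rw [← exp_add, ← exp_add, ← exp_add]
  apply exp_le_exp.2
  have h1 : (l / k) ^ 2 ≤ l ^ 2 := by
    rw [div_pow]
    exact div_le_self (sq_nonneg l) (one_le_pow₀ hk)
  have h2 : t ^ 2 ≤ T ^ 2 := sq_le_sq.2 (ht.trans (le_abs_self T))
  nlinarith [sq_nonneg (l - s), sq_nonneg (t - l / k)]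

section LocalComparison

variable {ℓ ρ : ℝ → ℝ} {A A' : ℝ}

lemma norm_loss_mul_gaussian_mul_prior_le (hℓnonneg : ∀ x, 0 ≤ ℓ x) (hρnonneg : ∀ x, 0 ≤ ρ x)
    (hℓA : ∀ x, ℓ x ≤ A * exp (x ^ 2 / 16)) (hρA : ∀ x, ρ x ≤ A' * exp (x ^ 2 / 16))
    {s t k T : ℝ} (hk : 1 ≤ k) (ht : |t| ≤ T) (l : ℝ) :
    ‖ℓ (l + s) * exp (-(l ^ 2) / 2) * ρ (t + l / k)‖
      ≤ A * A' * (exp ((s ^ 2 + T ^ 2) / 8) * exp (-(1 / 4) * l ^ 2)) := by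
  have hA : 0 ≤ A := nonneg_of_mul_nonneg_left ((hℓnonneg 0).trans (hℓA 0)) (exp_pos _)
  have hA' : 0 ≤ A' := nonneg_of_mul_nonneg_left ((hρnonneg 0).trans (hρA 0)) (exp_pos _)
  rw [norm_of_nonneg (mul_nonneg (mul_nonneg (hℓnonneg _) (exp_pos _).le) (hρnonneg _))]
  calc ℓ (l + s) * exp (-(l ^ 2) / 2) * ρ (t + l / k)
      ≤ (A * exp ((l + s) ^ 2 / 16)) * exp (-(l ^ 2) / 2)
          * (A' * exp ((t + l / k) ^ 2 / 16)) := by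
        gcongr
        · exact hρnonneg _
        · exact hℓA _
        · exact hρA _
    _ = A * A' * (exp ((l + s) ^ 2 / 16) * exp (-(l ^ 2) / 2)
          * exp ((t + l / k) ^ 2 / 16)) := by ring
    _ ≤ _ := mul_le_mul_of_nonneg_left (exp_mul_exp_mul_exp_le hk ht) (mul_nonneg hA hA')

lemma integrable_loss_mul_gaussian_mul_prior (hℓMeas : Measurable ℓ) (hρMeas : Measurable ρ)
    (hℓnonneg : ∀ x, 0 ≤ ℓ x) (hρnonneg : ∀ x, 0 ≤ ρ x)
    (hℓA : ∀ x, ℓ x ≤ A * exp (x ^ 2 / 16)) (hρA : ∀ x, ρ x ≤ A' * exp (x ^ 2 / 16))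
    (s t : ℝ) {k : ℝ} (hk : 1 ≤ k) :
    Integrable fun l => ℓ (l + s) * exp (-(l ^ 2) / 2) * ρ (t + l / k) := by
  refine Integrable.mono' (((integrable_exp_neg_mul_sq (by norm_num : (0 : ℝ) < 1 / 4)).const_mul
    (exp ((s ^ 2 + |t| ^ 2) / 8))).const_mul (A * A')) ?_ (Eventually.of_forall fun l =>
    norm_loss_mul_gaussian_mul_prior_le hℓnonneg hρnonneg hℓA hρA hk le_rfl l)
  exact Measurable.aestronglyMeasurable (by fun_prop)

lemma integrable_loss_mul_gaussian (hℓMeas : Measurable ℓ) (hℓnonneg : ∀ x, 0 ≤ ℓ x)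
    (hℓA : ∀ x, ℓ x ≤ A * exp (x ^ 2 / 16)) (s : ℝ) :
    Integrable fun l => ℓ (l + s) * exp (-(l ^ 2) / 2) := by
  simpa using integrable_loss_mul_gaussian_mul_prior (ρ := fun _ => 1) (A' := 1) hℓMeas
    measurable_const hℓnonneg (fun _ => zero_le_one) hℓA
    (fun x => by simpa using by positivity) s 0 le_rfl

/-- The local posterior risk at zero shift converges to the Gaussian risk times the prior. -/
lemma tendsto_integral_loss_mul_gaussian_mul_prior (hℓMeas : Measurable ℓ) (hρMeas : Measurable ρ)
    (hℓnonneg : ∀ x, 0 ≤ ℓ x) (hρnonneg : ∀ x, 0 ≤ ρ x)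
    (hℓA : ∀ x, ℓ x ≤ A * exp (x ^ 2 / 16)) (hρA : ∀ x, ρ x ≤ A' * exp (x ^ 2 / 16))
    {t : ℝ} (hρt : ContinuousAt ρ t) :
    Tendsto (fun p : ℝ × ℝ => ∫ l, ℓ l * exp (-(l ^ 2) / 2) * ρ (p.2 + l / p.1))
      (atTop ×ˢ nhds t) (nhds (∫ l, ℓ l * exp (-(l ^ 2) / 2) * ρ t)) := by
  refine tendsto_integral_filter_of_dominated_convergence
    (fun l => A * A' * (exp ((0 ^ 2 + (|t| + 1) ^ 2) / 8) * exp (-(1 / 4) * l ^ 2))) ?_ ?_ ?_ ?_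
  · exact Eventually.of_forall fun p => Measurable.aestronglyMeasurable (by fun_prop)
  · have h1 : ∀ᶠ p : ℝ × ℝ in atTop ×ˢ nhds t, 1 ≤ p.1 :=
      tendsto_fst.eventually (eventually_ge_atTop 1)
    have h2 : ∀ᶠ p : ℝ × ℝ in atTop ×ˢ nhds t, |p.2| ≤ |t| + 1 := by
      have h : ∀ᶠ x in nhds t, |x| ≤ |t| + 1 :=
        (continuous_abs.continuousAt.eventually (eventually_lt_nhds (lt_add_one |t|))).mono
          fun x hx => hx.le
      exact tendsto_snd.eventually h
    filter_upwards [h1, h2] with p hp1 hp2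
    refine Eventually.of_forall fun l => ?_
    simpa using norm_loss_mul_gaussian_mul_prior_le (s := 0) hℓnonneg hρnonneg hℓA hρA hp1 hp2 l
  · exact ((integrable_exp_neg_mul_sq (by norm_num : (0 : ℝ) < 1 / 4)).const_mul _).const_mul _
  · refine Eventually.of_forall fun l => Tendsto.const_mul _ (hρt.tendsto.comp ?_)
    have h1 : Tendsto (fun p : ℝ × ℝ => l / p.1) (atTop ×ˢ nhds t) (nhds 0) :=
      tendsto_const_nhds.div_atTop tendsto_fst
    simpa using tendsto_snd.add h1

/-- Truncating the Gaussian weight to `[-R, R]` recovers the full integral as `R → ∞`. -/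
lemma tendsto_integral_mul_indicator_Icc {f g : ℝ → ℝ} (h : Integrable fun x => f x * g x) :
    Tendsto (fun R : ℕ => ∫ x, f x * (Set.Icc (-(R : ℝ)) R).indicator g x) atTop
      (nhds (∫ x, f x * g x)) := by
  have heq : ∀ (R : ℕ) x, f x * (Set.Icc (-(R : ℝ)) R).indicator g x
      = (Set.Icc (-(R : ℝ)) R).indicator (fun x => f x * g x) x := by
    intro R x
    by_cases hx : x ∈ Set.Icc (-(R : ℝ)) R <;> simp [hx]
  simp only [heq]
  refine tendsto_integral_of_dominated_convergence (fun x => ‖f x * g x‖)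
    (fun R => h.aestronglyMeasurable.indicator measurableSet_Icc) h.norm
    (fun R => Eventually.of_forall fun x => norm_indicator_le_norm_self _ _)
    (Eventually.of_forall fun x => ?_)
  refine tendsto_const_nhds.congr' ?_
  filter_upwards [eventually_ge_atTop ⌈|x|⌉₊] with R hR
  have : |x| ≤ R := (Nat.le_ceil _).trans (by exact_mod_cast hR)
  rw [Set.indicator_of_mem (Set.mem_Icc.2 (abs_le.1 this))]

/-- Local comparison of risks: near a point where the prior is positive, every shift of size at
least `ε` is strictly worse than the zero shift, once the scale is large. -/
lemma eventually_forall_integral_lt_integral_shift (hℓMeas : Measurable ℓ) (hρMeas : Measurable ρ)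
    (hℓnonneg : ∀ x, 0 ≤ ℓ x) (hρnonneg : ∀ x, 0 ≤ ρ x)
    (hℓabs : ∀ x y, |x| ≤ |y| → ℓ x ≤ ℓ y)
    (hℓA : ∀ x, ℓ x ≤ A * exp (x ^ 2 / 16)) (hρA : ∀ x, ρ x ≤ A' * exp (x ^ 2 / 16))
    {t : ℝ} (hρt : ContinuousAt ρ t) (hρtpos : 0 < ρ t) {ε : ℝ} (hε : 0 < ε)
    (hψ : ∫ l, ℓ l * exp (-(l ^ 2) / 2) < ∫ l, ℓ (l + ε) * exp (-(l ^ 2) / 2)) :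
    ∀ᶠ p : ℝ × ℝ in atTop ×ˢ nhds t, ∀ s, ε ≤ |s| →
      ∫ l, ℓ l * exp (-(l ^ 2) / 2) * ρ (p.2 + l / p.1)
        < ∫ l, ℓ (l + s) * exp (-(l ^ 2) / 2) * ρ (p.2 + l / p.1) := by
  obtain ⟨R, hR⟩ := ((tendsto_integral_mul_indicator_Icc
    (integrable_loss_mul_gaussian hℓMeas hℓnonneg hℓA ε)).eventually
    (eventually_gt_nhds hψ)).exists
  set g : ℝ → ℝ := (Set.Icc (-(R : ℝ)) R).indicator fun l => exp (-(l ^ 2) / 2) with hg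
  set u := ∫ l, ℓ l * exp (-(l ^ 2) / 2) with hu
  set v := ∫ l, ℓ (l + ε) * g l with hv
  have hu0 : 0 ≤ u := integral_nonneg fun l => mul_nonneg (hℓnonneg l) (exp_pos _).le
  have hv0 : 0 < v := hu0.trans_lt hR
  have hg0 : ∀ l, 0 ≤ g l := fun l => Set.indicator_nonneg (fun _ _ => (exp_pos _).le) l
  have hgle : ∀ l, g l ≤ exp (-(l ^ 2) / 2) := fun l =>
    Set.indicator_le_self' (fun _ _ => (exp_pos _).le) l
  have hgmeas : Measurable g := Measurable.indicator (by fun_prop) measurableSet_Icc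
  have hganti : ∀ x y, |x| ≤ |y| → g y ≤ g x := by
    intro x y hxy
    by_cases hy : y ∈ Set.Icc (-(R : ℝ)) R
    · have hx : x ∈ Set.Icc (-(R : ℝ)) R := abs_le.1 (hxy.trans (abs_le.2 hy))
      rw [hg, Set.indicator_of_mem hy, Set.indicator_of_mem hx]
      exact exp_le_exp.2 (by linarith [sq_le_sq.2 hxy])
    · rw [hg, Set.indicator_of_notMem hy]
      exact hg0 x
  have hgint : ∀ s, Integrable fun l => ℓ (l + s) * g l := fun s =>
    (integrable_loss_mul_gaussian hℓMeas hℓnonneg hℓA s).mono'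
      (Measurable.aestronglyMeasurable (by fun_prop)) (Eventually.of_forall fun l => by
        rw [norm_of_nonneg (mul_nonneg (hℓnonneg _) (hg0 _))]
        exact mul_le_mul_of_nonneg_left (hgle l) (hℓnonneg _))
  obtain ⟨w, hw1, hw2⟩ : ∃ w, ρ t * u < w ∧ w < ρ t * v :=
    exists_between (mul_lt_mul_of_pos_left hR hρtpos)
  have hw0 : 0 < w := (mul_nonneg hρtpos.le hu0).trans_lt hw1
  have hq : w / v < ρ t := by rwa [div_lt_iff₀ hv0]
  have hup : ∀ᶠ p : ℝ × ℝ in atTop ×ˢ nhds t,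
      ∫ l, ℓ l * exp (-(l ^ 2) / 2) * ρ (p.2 + l / p.1) < w := by
    refine (tendsto_integral_loss_mul_gaussian_mul_prior hℓMeas hρMeas hℓnonneg hρnonneg hℓA hρA
      hρt).eventually (eventually_lt_nhds ?_)
    rw [integral_mul_const, mul_comm]
    exact hw1
  obtain ⟨δ, hδ, hball⟩ := Metric.eventually_nhds_iff.1 (hρt.eventually (eventually_gt_nhds hq))
  have h1 : ∀ᶠ p : ℝ × ℝ in atTop ×ˢ nhds t, 1 ≤ p.1 :=
    tendsto_fst.eventually (eventually_ge_atTop 1)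
  have h2 : ∀ᶠ p : ℝ × ℝ in atTop ×ˢ nhds t, dist p.2 t < δ / 2 :=
    tendsto_snd.eventually (Metric.eventually_nhds_iff.2 ⟨δ / 2, by positivity, fun _ h => h⟩)
  have h3 : ∀ᶠ p : ℝ × ℝ in atTop ×ˢ nhds t, (R : ℝ) / p.1 < δ / 2 :=
    (tendsto_const_nhds.div_atTop tendsto_fst).eventually (eventually_lt_nhds (by positivity))
  filter_upwards [hup, h1, h2, h3] with p hp0 hp1 hp2 hp3 s hs
  refine hp0.trans_le ?_
  calc w = w / v * v := by field_simp
    _ ≤ w / v * ∫ l, ℓ (l + s) * g l :=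
        mul_le_mul_of_nonneg_left
          (integral_shift_mul_le_of_abs_le hℓabs hganti hgint (by rwa [abs_of_pos hε]))
          (by positivity)
    _ = ∫ l, w / v * (ℓ (l + s) * g l) := (integral_const_mul _ _).symm
    _ ≤ _ := by
      refine integral_mono ((hgint s).const_mul _)
        (integrable_loss_mul_gaussian_mul_prior hℓMeas hρMeas hℓnonneg hρnonneg hℓA hρA s p.2 hp1)
        fun l => ?_
      change w / v * (ℓ (l + s) * g l) ≤ ℓ (l + s) * exp (-(l ^ 2) / 2) * ρ (p.2 + l / p.1)
      by_cases hl : l ∈ Set.Icc (-(R : ℝ)) R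
      · rw [hg, Set.indicator_of_mem hl, mul_comm]
        refine mul_le_mul_of_nonneg_left (hball ?_).le
          (mul_nonneg (hℓnonneg _) (exp_pos _).le)
        have hp1' : 0 < p.1 := by linarith
        have : |l / p.1| ≤ R / p.1 := by
          rw [abs_div, abs_of_pos hp1']
          exact div_le_div_of_nonneg_right (abs_le.2 hl) hp1'.le
        rw [dist_eq] at hp2 ⊢
        calc |p.2 + l / p.1 - t| = |(p.2 - t) + l / p.1| := by congr 1; ring
          _ ≤ |p.2 - t| + |l / p.1| := abs_add_le _ _
          _ < δ := by linarith
      · rw [hg, Set.indicator_of_notMem hl, mul_zero, mul_zero]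
        exact mul_nonneg (mul_nonneg (hℓnonneg _) (exp_pos _).le) (hρnonneg _)

end LocalComparison

/-- The exponential of a subquadratic power is at most a multiple of `exp (x² / 16)`. -/
lemma exists_le_const_mul_exp_sq_of_rpow {c r c₁ : ℝ} (hc : 0 < c) (hr : 0 < r) (hr2 : r < 2)
    (hc₁ : 0 ≤ c₁) :
    ∃ A, 0 ≤ A ∧ ∀ x : ℝ, c₁ * exp (c * |x| ^ r) ≤ A * exp (x ^ 2 / 16) := by
  obtain ⟨C, hC⟩ := exists_mul_rpow_le_add_mul_sq hc hr hr2 (by norm_num : (0 : ℝ) < 1 / 16)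
  refine ⟨c₁ * exp C, by positivity, fun x => ?_⟩
  rw [mul_assoc, ← exp_add]
  refine mul_le_mul_of_nonneg_left (exp_le_exp.2 ?_) hc₁
  have := hC |x| (abs_nonneg x)
  rw [sq_abs] at this
  linarith

/-- Uniform asymptotic equivalence in probability of the Bayesian estimator with scaled loss
and the MLE: `sup_{θ₀ ∈ B} ℙ(√I_N |β̃_N^{θ₀} − θ̂_N^{θ₀}| > ε) → 0` for every compact
`B ⊂ (0,∞)` and every `ε > 0`. -/
theorem uniform_bayes_scaled_loss_equiv_mle
    {Ω : Type*} [MeasurableSpace Ω] (P : Measure Ω) [IsProbabilityMeasure P]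
    (ξ : ℕ → Ω → ℝ) (hξMeas : ∀ N, Measurable (ξ N))
    (hξGauss : ∀ N, Measure.map (ξ N) P = gaussianReal 0 1)
    (I : ℕ → ℝ) (hIpos : ∀ N, 0 < I N) (hItop : Tendsto I atTop atTop)
    -- the loss function ℓ is of class W_{e,2}
    (ℓ : ℝ → ℝ) (hℓMeas : Measurable ℓ) (hℓnonneg : ∀ x, 0 ≤ ℓ x)
    (hℓsymm : ∀ x, ℓ (-x) = ℓ x) (hℓmono : MonotoneOn ℓ (Set.Ici 0))
    (hℓ0 : ℓ 0 = 0) (hℓcont : ContinuousAt ℓ 0) (hℓne : ∃ x, ℓ x ≠ 0)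
    (hℓgrowth : ∃ c > (0 : ℝ), ∃ r : ℝ, 0 < r ∧ r < 2 ∧
      ∀ x, ℓ x ≤ Real.exp (c * |x| ^ r))
    -- the prior ϱ is of class Q_{e,2}
    (ρ : ℝ → ℝ) (hρnonneg : ∀ x, 0 ≤ ρ x) (hρzero : ∀ x ≤ (0 : ℝ), ρ x = 0)
    (hρcont : ContinuousOn ρ (Set.Ioi 0)) (hρpos : ∀ θ : ℝ, 0 < θ → 0 < ρ θ)
    (hρgrowth : ∃ c₁ > (0 : ℝ), ∃ c₂ > (0 : ℝ), ∃ r : ℝ, 0 < r ∧ r < 2 ∧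
      ∀ θ : ℝ, 0 < θ → ρ θ ≤ c₁ * Real.exp (c₂ * θ ^ r))
    -- ψ(s) := ∫ ℓ(λ+s) e^{−λ²/2} dλ has a strict minimum at s = 0
    (hψ : ∀ s : ℝ, s ≠ 0 →
      (∫ l : ℝ, ℓ l * Real.exp (-(l ^ 2) / 2)) <
        ∫ l : ℝ, ℓ (l + s) * Real.exp (-(l ^ 2) / 2))
    -- the Bayesian estimators with respect to the scaled loss ℓ(√I_N ·)
    (βt : ℝ → ℕ → Ω → ℝ)
    (hβtpos : ∀ θ₀ : ℝ, 0 < θ₀ → ∀ N ω, 0 < βt θ₀ N ω)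
    (hβtmin : ∀ θ₀ : ℝ, 0 < θ₀ → ∀ N ω, ∀ β : ℝ, 0 < β →
      (∫ η in Set.Ioi (0 : ℝ),
          ℓ (Real.sqrt (I N) * (η - βt θ₀ N ω)) *
            Real.exp (-(I N * (η - (θ₀ + ξ N ω / Real.sqrt (I N))) ^ 2) / 2) * ρ η) ≤
        ∫ η in Set.Ioi (0 : ℝ),
          ℓ (Real.sqrt (I N) * (η - β)) *
            Real.exp (-(I N * (η - (θ₀ + ξ N ω / Real.sqrt (I N))) ^ 2) / 2) * ρ η) :
    ∀ B : Set ℝ, IsCompact B → B ⊆ Set.Ioi 0 → ∀ ε > (0 : ℝ),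
      Tendsto (fun N => ⨆ θ₀ ∈ B,
          P {ω : Ω |
            ε < Real.sqrt (I N) * |βt θ₀ N ω - (θ₀ + ξ N ω / Real.sqrt (I N))|})
        atTop (nhds 0) := by
  intro B hB hBpos ε hε
  have hℓabs : ∀ x y, |x| ≤ |y| → ℓ x ≤ ℓ y := by
    have h : ∀ x, ℓ |x| = ℓ x := fun x => by
      rcases abs_choice x with hx | hx <;> rw [hx]
      exact hℓsymm x
    intro x y hxy
    rw [← h x, ← h y]
    exact hℓmono (abs_nonneg x) (abs_nonneg y) hxy
  have hρMeas : Measurable ρ := by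
    have h : ρ = (Set.Ioi (0 : ℝ)).piecewise ρ 0 := by
      ext x
      by_cases hx : x ∈ Set.Ioi (0 : ℝ)
      · simp [hx]
      · rw [Set.piecewise_eq_of_notMem _ _ _ hx]
        exact hρzero x (not_lt.1 hx)
    rw [h]
    exact hρcont.measurable_piecewise continuousOn_const measurableSet_Ioi
  obtain ⟨c, hc, r, hr, hr2, hℓle⟩ := hℓgrowth
  obtain ⟨c₁, hc₁, c₂, hc₂, q, hq, hq2, hρle⟩ := hρgrowth
  obtain ⟨A, -, hA⟩ := exists_le_const_mul_exp_sq_of_rpow hc hr hr2 zero_le_one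
  obtain ⟨A', hA'0, hA'⟩ := exists_le_const_mul_exp_sq_of_rpow hc₂ hq hq2 hc₁.le
  have hℓA : ∀ x, ℓ x ≤ A * exp (x ^ 2 / 16) := fun x =>
    (hℓle x).trans (by simpa using hA x)
  have hρA : ∀ x, ρ x ≤ A' * exp (x ^ 2 / 16) := fun x => by
    rcases le_or_gt x 0 with hx | hx
    · rw [hρzero x hx]; positivity
    · exact (hρle x hx).trans (by simpa [abs_of_pos hx] using hA' x)
  obtain ⟨δ, hδ, hKsub⟩ := hB.exists_cthickening_subset_open isOpen_Ioi hBpos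
  have hK : IsCompact (Metric.cthickening δ B) := hB.cthickening
  have hunif : ∀ᶠ k : ℝ in atTop, ∀ t ∈ Metric.cthickening δ B, ∀ s, ε ≤ |s| →
      ∫ l, ℓ l * exp (-(l ^ 2) / 2) * ρ (t + l / k)
        < ∫ l, ℓ (l + s) * exp (-(l ^ 2) / 2) * ρ (t + l / k) := by
    have hloc : ∀ t ∈ Metric.cthickening δ B, ∀ᶠ p : ℝ × ℝ in atTop ×ˢ nhds t, ∀ s, ε ≤ |s| →
        ∫ l, ℓ l * exp (-(l ^ 2) / 2) * ρ (p.2 + l / p.1)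
          < ∫ l, ℓ (l + s) * exp (-(l ^ 2) / 2) * ρ (p.2 + l / p.1) := fun t ht =>
      eventually_forall_integral_lt_integral_shift hℓMeas hρMeas hℓnonneg hρnonneg hℓabs hℓA hρA
        (hρcont.continuousAt (Ioi_mem_nhds (hKsub ht))) (hρpos t (hKsub ht)) hε (hψ ε hε.ne')
    refine hK.induction_on (p := fun S => ∀ᶠ k : ℝ in atTop, ∀ t ∈ S, ∀ s, ε ≤ |s| →
      ∫ l, ℓ l * exp (-(l ^ 2) / 2) * ρ (t + l / k)
        < ∫ l, ℓ (l + s) * exp (-(l ^ 2) / 2) * ρ (t + l / k)) (by simp)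
      (fun S T hST h => h.mono fun k hk t ht => hk t (hST ht))
      (fun S T hS hT => by
        filter_upwards [hS, hT] with k hkS hkT t ht
        exact ht.elim (hkS t) (hkT t)) fun t ht => ?_
    obtain ⟨pa, hpa, pb, hpb, h⟩ := eventually_prod_iff.1 (hloc t ht)
    exact ⟨{x | pb x}, mem_nhdsWithin_of_mem_nhds hpb, hpa.mono fun k hk x hx => h hk hx⟩
  have hsqrt : Tendsto (fun N => √(I N)) atTop atTop := tendsto_sqrt_atTop.comp hItop
  rw [ENNReal.tendsto_nhds_zero]
  intro e he
  obtain ⟨C, hC, hCe⟩ := isTightMeasureSet_iff_exists_isCompact_measure_compl_le.1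
    (isTightMeasureSet_singleton (μ := gaussianReal 0 1)) e he
  obtain ⟨M, hM⟩ := hC.isBounded.exists_norm_le
  have hMδ : ∀ᶠ N in atTop, M / √(I N) < δ :=
    (tendsto_const_nhds.div_atTop hsqrt).eventually (eventually_lt_nhds hδ)
  filter_upwards [hsqrt.eventually hunif, hMδ] with N hN hNδ
  have hk : 0 < √(I N) := sqrt_pos.2 (hIpos N)
  refine iSup₂_le fun θ₀ hθ₀ => ?_
  have hsub : {ω : Ω | ε < √(I N) * |βt θ₀ N ω - (θ₀ + ξ N ω / √(I N))|} ⊆ ξ N ⁻¹' Cᶜ := by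
    intro ω hω hωC
    have hωM : |ξ N ω| ≤ M := hM _ hωC
    have ht : θ₀ + ξ N ω / √(I N) ∈ Metric.cthickening δ B := by
      refine Metric.mem_cthickening_of_dist_le _ θ₀ _ _ hθ₀ ?_
      rw [dist_eq, add_sub_cancel_left, abs_div, abs_of_pos hk]
      exact (div_le_div_of_nonneg_right hωM hk.le).trans hNδ.le
    have hmin := hβtmin θ₀ (hBpos hθ₀) N ω _ (hKsub ht)
    rw [setIntegral_Ioi_eq_inv_mul_integral_rescaled hρzero (hIpos N),
      setIntegral_Ioi_eq_inv_mul_integral_rescaled hρzero (hIpos N)] at hmin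
    simp only [sub_self, mul_zero, add_zero] at hmin
    refine absurd (le_of_mul_le_mul_left hmin (inv_pos.2 hk)) (not_le.2 (hN _ ht _ ?_))
    rw [abs_mul, abs_of_pos hk, abs_sub_comm]
    exact le_of_lt hω
  calc P {ω : Ω | ε < √(I N) * |βt θ₀ N ω - (θ₀ + ξ N ω / √(I N))|}
      ≤ P (ξ N ⁻¹' Cᶜ) := measure_mono hsub
    _ = gaussianReal 0 1 Cᶜ := by
        rw [← hξGauss N, Measure.map_apply (hξMeas N) hC.measurableSet.compl]
    _ ≤ e := hCe _ rfl
end
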